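/- Let Z be a compact subset of the unit sphere S² of ℝ³ and let Φ : Z × [0,∞) → Z be a continuous semiflow. If z ∈ Z is recurrent with respect to Φ, then z is either a fixed point of Φ or a periodic point of Φ. -/

import Mathlib

open scoped NNReal
open Filter Topology

namespace PlanarRecurrence

open Set

/-- A nowhere vanishing continuous function on a simply connected, locally path connected space
has a continuous logarithm. -/
theorem exists_continuous_log {X : Type*} [TopologicalSpace X] [SimplyConnectedSpace X]
    [LocallyPathConnectedSpace X] {f : X → ℂ} (hf : Continuous f) (h0 : ∀ x, f x ≠ 0) :
    ∃ g : X → ℂ, Continuous g ∧ ∀ x, Complex.exp (g x) = f x := by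
  obtain ⟨x₀⟩ : Nonempty X := PathConnectedSpace.nonempty
  rcases Complex.isCoveringMapOn_exp.existsUnique_continuousMap_lifts (a₀ := x₀)
    ⟨f, hf⟩ (Complex.exp_log (h0 x₀)) (fun x ↦ h0 x) with ⟨g, ⟨-, hg⟩, -⟩
  exact ⟨g, g.continuous, fun x ↦ congrFun hg x⟩

theorem eq_of_exp_eq_one_of_norm_sub_lt {p q : ℂ} (hp : Complex.exp p = 1)
    (hq : Complex.exp q = 1) (h : ‖p - q‖ < 1) : p = q := by
  have h1 : Complex.exp (p - q) = 1 := by rw [Complex.exp_sub, hp, hq, div_one]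
  obtain ⟨n, hn⟩ := Complex.exp_eq_one_iff.1 h1
  rw [hn] at h
  have h2 : ‖(n : ℂ) * (2 * Real.pi * Complex.I)‖ = |(n : ℝ)| * (2 * Real.pi) := by
    simp [abs_of_pos Real.pi_pos]
  rw [h2] at h
  have hn0 : n = 0 := by
    by_contra hne
    have h3 : (1 : ℝ) ≤ |(n : ℝ)| := by
      have := Int.one_le_abs hne
      exact_mod_cast this
    nlinarith [Real.pi_gt_three]
  rw [hn0] at hn
  simpa [sub_eq_zero] using hn

/-- `G` is a continuous logarithm of `f` on `[a, b]`. -/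
def IsLogOn (G f : ℝ → ℂ) (a b : ℝ) : Prop :=
  ContinuousOn G (Icc a b) ∧ ∀ t ∈ Icc a b, Complex.exp (G t) = f t

theorem exists_isLogOn {f : ℝ → ℂ} {a b : ℝ} (hab : a ≤ b) (hf : ContinuousOn f (Icc a b))
    (h0 : ∀ t ∈ Icc a b, f t ≠ 0) : ∃ G, IsLogOn G f a b := by
  have hc : Continuous (IccExtend hab ((Icc a b).domRestrict f)) :=
    (continuousOn_iff_continuous_domRestrict.1 hf).Icc_extend'
  obtain ⟨g, hg, hgf⟩ := exists_continuous_log hc (fun x ↦ h0 _ (projIcc a b hab x).2)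
  refine ⟨g, hg.continuousOn, fun t ht ↦ ?_⟩
  rw [hgf, IccExtend_of_mem _ _ ht]
  rfl

open Classical in
/-- The variation of a continuous logarithm of `f` from `a` to `b`. -/
noncomputable def logVar (f : ℝ → ℂ) (a b : ℝ) : ℂ :=
  if h : ∃ G, IsLogOn G f a b then h.choose b - h.choose a else 0

theorem IsLogOn.logVar_eq {G f : ℝ → ℂ} {a b : ℝ} (hab : a ≤ b) (h : IsLogOn G f a b) :
    logVar f a b = G b - G a := by
  have hex : ∃ G, IsLogOn G f a b := ⟨G, h⟩
  rw [logVar, dif_pos hex]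
  obtain ⟨hc, he⟩ := hex.choose_spec
  set H := hex.choose
  have ha : a ∈ Icc a b := left_mem_Icc.2 hab
  have key : EqOn H (fun t ↦ G t + (H a - G a)) (Icc a b) := by
    refine Complex.isCoveringMap_exp.eqOn_of_comp_eqOn isPreconnected_Icc hc
      (h.1.add continuousOn_const) (fun t ht ↦ Subtype.ext ?_) ha (by ring)
    change Complex.exp (H t) = Complex.exp (G t + (H a - G a))
    rw [Complex.exp_add, Complex.exp_sub, he t ht, h.2 t ht, he a ha, h.2 a ha, div_self, mul_one]
    rw [← h.2 a ha]
    exact Complex.exp_ne_zero _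
  rw [key (right_mem_Icc.2 hab)]
  ring

theorem IsLogOn.mono {G f : ℝ → ℂ} {a b c d : ℝ} (h : IsLogOn G f a b) (hc : a ≤ c) (hd : d ≤ b) :
    IsLogOn G f c d :=
  ⟨h.1.mono (Icc_subset_Icc hc hd), fun t ht ↦ h.2 t (Icc_subset_Icc hc hd ht)⟩

theorem IsLogOn.mul {F G f g : ℝ → ℂ} {a b : ℝ} (hF : IsLogOn F f a b) (hG : IsLogOn G g a b) :
    IsLogOn (F + G) (f * g) a b :=
  ⟨hF.1.add hG.1, fun t ht ↦ by
    rw [Pi.add_apply, Complex.exp_add, hF.2 t ht, hG.2 t ht, Pi.mul_apply]⟩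

theorem IsLogOn.congr {F f g : ℝ → ℂ} {a b : ℝ} (hF : IsLogOn F f a b)
    (h : EqOn f g (Icc a b)) : IsLogOn F g a b :=
  ⟨hF.1, fun t ht ↦ by rw [hF.2 t ht, h ht]⟩

theorem exp_logVar {f : ℝ → ℂ} {a b : ℝ} (hab : a ≤ b) (hf : ContinuousOn f (Icc a b))
    (h0 : ∀ t ∈ Icc a b, f t ≠ 0) : Complex.exp (logVar f a b) = f b / f a := by
  obtain ⟨G, hG⟩ := exists_isLogOn hab hf h0
  rw [hG.logVar_eq hab, Complex.exp_sub, hG.2 _ (left_mem_Icc.2 hab), hG.2 _ (right_mem_Icc.2 hab)]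

theorem logVar_add {f : ℝ → ℂ} {a b c : ℝ} (hab : a ≤ b) (hbc : b ≤ c)
    (hf : ContinuousOn f (Icc a c)) (h0 : ∀ t ∈ Icc a c, f t ≠ 0) :
    logVar f a b + logVar f b c = logVar f a c := by
  obtain ⟨G, hG⟩ := exists_isLogOn (hab.trans hbc) hf h0
  rw [hG.logVar_eq (hab.trans hbc), (hG.mono le_rfl hbc).logVar_eq hab,
    (hG.mono hab le_rfl).logVar_eq hbc]
  ring

theorem logVar_neg {f : ℝ → ℂ} {a b : ℝ} (hab : a ≤ b) (hf : ContinuousOn f (Icc a b))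
    (h0 : ∀ t ∈ Icc a b, f t ≠ 0) : logVar (fun t ↦ -f t) a b = logVar f a b := by
  obtain ⟨G, hG⟩ := exists_isLogOn hab hf h0
  have h1 : IsLogOn (fun t ↦ G t + Real.pi * Complex.I) (fun t ↦ -f t) a b :=
    ⟨hG.1.add continuousOn_const, fun t ht ↦ by
      rw [Complex.exp_add, hG.2 t ht, Complex.exp_pi_mul_I]; ring⟩
  rw [hG.logVar_eq hab, h1.logVar_eq hab]
  ring

theorem mem_slitPlane_of_norm_sub_one_lt {z : ℂ} (h : ‖z - 1‖ < 1) : z ∈ Complex.slitPlane := by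
  simpa using Complex.mem_slitPlane_of_norm_lt_one (z := z - 1) h

/-- If `f / g` takes its values in the slit plane, then the logarithmic variations of `f` and `g`
differ by the principal logarithms at the end points. -/
theorem logVar_eq_add_log {f g : ℝ → ℂ} {a b : ℝ} (hab : a ≤ b) (hf : ContinuousOn f (Icc a b))
    (hg : ContinuousOn g (Icc a b)) (h0 : ∀ t ∈ Icc a b, g t ≠ 0)
    (hs : ∀ t ∈ Icc a b, f t / g t ∈ Complex.slitPlane) :
    logVar f a b = logVar g a b + (Complex.log (f b / g b) - Complex.log (f a / g a)) := by
  obtain ⟨G, hG⟩ := exists_isLogOn hab hg h0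
  have h1 : IsLogOn (fun t ↦ Complex.log (f t / g t)) (fun t ↦ f t / g t) a b :=
    ⟨(hf.div hg h0).clog hs, fun t ht ↦ Complex.exp_log (Complex.slitPlane_ne_zero (hs t ht))⟩
  have h2 := (hG.mul h1).congr (g := f) (fun t ht ↦ by
    simp only [Pi.mul_apply]
    rw [mul_div_cancel₀ _ (h0 t ht)])
  rw [h2.logVar_eq hab, hG.logVar_eq hab]
  simp only [Pi.add_apply]
  ring

theorem norm_log_le_of_norm_sub_one_le {z : ℂ} {κ : ℝ} (hκ : κ ≤ 1 / 2) (h : ‖z - 1‖ ≤ κ) :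
    ‖Complex.log z‖ ≤ 3 / 2 * κ := by
  have := Complex.norm_log_one_add_half_le_self (z := z - 1) (h.trans hκ)
  rw [add_sub_cancel] at this
  linarith

theorem norm_div_sub_one_le {p q : ℂ} {κ : ℝ} (hq : q ≠ 0) (h : ‖p - q‖ ≤ κ * ‖q‖) :
    ‖p / q - 1‖ ≤ κ := by
  rw [div_sub_one hq, norm_div]
  exact div_le_of_le_mul₀ (norm_nonneg _) (by
    by_contra hneg
    have := norm_pos_iff.2 hq
    nlinarith [norm_nonneg (p - q)]) h

theorem norm_logVar_sub_le {f g : ℝ → ℂ} {a b κ : ℝ} (hab : a ≤ b) (hf : ContinuousOn f (Icc a b))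
    (hg : ContinuousOn g (Icc a b)) (h0 : ∀ t ∈ Icc a b, g t ≠ 0) (hκ : κ ≤ 1 / 2)
    (h : ∀ t ∈ Icc a b, ‖f t - g t‖ ≤ κ * ‖g t‖) : ‖logVar f a b - logVar g a b‖ ≤ 3 * κ := by
  have h1 : ∀ t ∈ Icc a b, ‖f t / g t - 1‖ ≤ κ := fun t ht ↦ norm_div_sub_one_le (h0 t ht) (h t ht)
  rw [logVar_eq_add_log hab hf hg h0 fun t ht ↦
    mem_slitPlane_of_norm_sub_one_lt ((h1 t ht).trans_lt (by linarith)), add_sub_cancel_left]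
  have ha := norm_log_le_of_norm_sub_one_le hκ (h1 a (left_mem_Icc.2 hab))
  have hb := norm_log_le_of_norm_sub_one_le hκ (h1 b (right_mem_Icc.2 hab))
  linarith [norm_sub_le (Complex.log (f b / g b)) (Complex.log (f a / g a))]

/-- Logarithmic variations along the two boundary paths of a rectangle agree. -/
theorem logVar_rectangle {f : ℝ → ℝ → ℂ} {a b c d : ℝ} (hab : a ≤ b) (hcd : c ≤ d)
    (hf : ContinuousOn (fun p : ℝ × ℝ ↦ f p.1 p.2) (Icc a b ×ˢ Icc c d))
    (h0 : ∀ u ∈ Icc a b, ∀ v ∈ Icc c d, f u v ≠ 0) :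
    logVar (fun v ↦ f a v) c d + logVar (fun u ↦ f u d) a b =
      logVar (fun u ↦ f u c) a b + logVar (fun v ↦ f b v) c d := by
  have hc : Continuous (fun p : ℝ × ℝ ↦ f (projIcc a b hab p.1) (projIcc c d hcd p.2)) := by
    refine hf.comp_continuous (f := fun p : ℝ × ℝ ↦
      ((projIcc a b hab p.1 : ℝ), (projIcc c d hcd p.2 : ℝ))) ?_
        fun p ↦ ⟨Subtype.prop _, Subtype.prop _⟩
    exact ((continuous_subtype_val.comp continuous_projIcc).comp continuous_fst).prodMk
      ((continuous_subtype_val.comp continuous_projIcc).comp continuous_snd)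
  have : SimplyConnectedSpace (ℝ × ℝ) := inferInstance
  obtain ⟨g, hg, hgf⟩ := exists_continuous_log hc (fun p ↦
    h0 _ (projIcc a b hab p.1).2 _ (projIcc c d hcd p.2).2)
  have hgf' : ∀ u ∈ Icc a b, ∀ v ∈ Icc c d, Complex.exp (g (u, v)) = f u v := by
    intro u hu v hv
    rw [hgf]
    simp only [projIcc_of_mem hab hu, projIcc_of_mem hcd hv]
  have hh : ∀ v ∈ Icc c d, IsLogOn (fun u ↦ g (u, v)) (fun u ↦ f u v) a b := fun v hv ↦
    ⟨by fun_prop, fun u hu ↦ hgf' u hu v hv⟩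
  have hv : ∀ u ∈ Icc a b, IsLogOn (fun v ↦ g (u, v)) (fun v ↦ f u v) c d := fun u hu ↦
    ⟨by fun_prop, fun v hv ↦ hgf' u hu v hv⟩
  rw [(hh c (left_mem_Icc.2 hcd)).logVar_eq hab, (hh d (right_mem_Icc.2 hcd)).logVar_eq hab,
    (hv a (left_mem_Icc.2 hab)).logVar_eq hcd, (hv b (right_mem_Icc.2 hab)).logVar_eq hcd]
  ring

/-! ### Continuity of logarithmic variations and the index of a loop -/

theorem norm_logVar_sub_const_le {γ : ℝ → ℂ} {a b κ : ℝ} {p x : ℂ} (hab : a ≤ b)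
    (hγ : ContinuousOn γ (Icc a b)) (hpx : p ≠ x) (hκ : κ ≤ 1 / 2)
    (h : ∀ t ∈ Icc a b, ‖γ t - p‖ ≤ κ * ‖p - x‖) :
    ‖logVar (fun t ↦ γ t - x) a b‖ ≤ 3 * κ := by
  have h1 : IsLogOn (fun _ ↦ Complex.log (p - x)) (fun _ ↦ p - x) a b :=
    ⟨continuousOn_const, fun t _ ↦ Complex.exp_log (sub_ne_zero.2 hpx)⟩
  have h2 := norm_logVar_sub_le (f := fun t ↦ γ t - x) (g := fun _ ↦ p - x) hab
    (hγ.sub continuousOn_const) continuousOn_const (fun _ _ ↦ sub_ne_zero.2 hpx) hκ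
    (fun t ht ↦ by simpa using h t ht)
  rwa [h1.logVar_eq hab, sub_self, sub_zero] at h2

theorem norm_log_div_le {p c x : ℂ} {κ : ℝ} (hc : c ≠ x) (hκ : κ ≤ 1 / 2)
    (h : ‖p - c‖ ≤ κ * ‖c - x‖) : ‖Complex.log ((p - x) / (c - x))‖ ≤ 3 / 2 * κ :=
  norm_log_le_of_norm_sub_one_le hκ (norm_div_sub_one_le (sub_ne_zero.2 hc) (by simpa using h))

theorem div_mem_slitPlane {p c x : ℂ} {r : ℝ} (hp : p ∈ Metric.closedBall c r)
    (hx : x ∉ Metric.closedBall c r) : (p - x) / (c - x) ∈ Complex.slitPlane := by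
  have hp' : ‖p - c‖ ≤ r := by simpa [dist_eq_norm] using hp
  have hx' : r < ‖c - x‖ := by simpa [dist_eq_norm, norm_sub_rev] using hx
  have hpos : 0 < ‖c - x‖ := (norm_nonneg _).trans_lt (hp'.trans_lt hx')
  refine mem_slitPlane_of_norm_sub_one_lt ?_
  rw [div_sub_one (norm_pos_iff.1 hpos), norm_div, div_lt_one hpos]
  simpa using hp'.trans_lt hx'

theorem continuousAt_log_div {p c x : ℂ} {r : ℝ} (hp : p ∈ Metric.closedBall c r)
    (hx : x ∉ Metric.closedBall c r) (hr : 0 ≤ r) :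
    ContinuousAt (fun z ↦ Complex.log ((p - z) / (c - z))) x := by
  refine ContinuousAt.clog ?_ (div_mem_slitPlane hp hx)
  refine (continuousAt_const.sub continuousAt_id).div (continuousAt_const.sub continuousAt_id) ?_
  rintro h
  exact hx ((sub_eq_zero.1 h) ▸ Metric.mem_closedBall_self hr)

theorem continuousAt_logVar {γ : ℝ → ℂ} {a b : ℝ} {x : ℂ} (hab : a ≤ b)
    (hγ : ContinuousOn γ (Icc a b)) (hx : x ∉ γ '' Icc a b) :
    ContinuousAt (fun z ↦ logVar (fun t ↦ γ t - z) a b) x := by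
  have hcl : IsClosed (γ '' Icc a b) := (isCompact_Icc.image_of_continuousOn hγ).isClosed
  obtain ⟨d, hd, hball⟩ := Metric.isOpen_iff.1 hcl.isOpen_compl x hx
  have hdist : ∀ t ∈ Icc a b, d ≤ ‖γ t - x‖ := by
    intro t ht
    by_contra! h
    exact hball (by simpa [dist_eq_norm] using h) (mem_image_of_mem γ ht)
  rw [Metric.continuousAt_iff]
  intro ε hε
  refine ⟨d * min (1 / 2) (ε / 4), by positivity, fun {z} hz ↦ ?_⟩
  rw [dist_eq_norm] at hz ⊢
  have := norm_logVar_sub_le (f := fun t ↦ γ t - z) (g := fun t ↦ γ t - x)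
    (κ := min (1 / 2) (ε / 4)) hab
    (hγ.sub continuousOn_const) (hγ.sub continuousOn_const)
    (fun t ht ↦ norm_pos_iff.1 (hd.trans_le (hdist t ht))) (min_le_left _ _) fun t ht ↦ by
      rw [sub_sub_sub_cancel_left, norm_sub_rev]
      refine hz.le.trans ?_
      rw [mul_comm]
      exact mul_le_mul_of_nonneg_left (hdist t ht) (by positivity)
  have h4 := min_le_right (1 / 2) (ε / 4)
  linarith

/-- A function with values in the periods of the exponential is locally constant where it is
continuous. -/
theorem eventually_eq_of_exp_eq_one {N : ℂ → ℂ} {x : ℂ} (hN : ContinuousAt N x)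
    (hx : Complex.exp (N x) = 1) (h : ∀ᶠ z in 𝓝 x, Complex.exp (N z) = 1) :
    ∀ᶠ z in 𝓝 x, N z = N x := by
  filter_upwards [h, Metric.continuousAt_iff'.1 hN 1 one_pos] with z hz hd
  exact eq_of_exp_eq_one_of_norm_sub_lt hz hx (by simpa [dist_eq_norm] using hd)

/-- The logarithmic variation about `x` of the curve `γ` on `[a, b]`, closed up through the
point `c`. -/
noncomputable def closedVar (γ : ℝ → ℂ) (a b : ℝ) (c x : ℂ) : ℂ :=
  logVar (fun t ↦ γ t - x) a b + Complex.log ((γ a - x) / (c - x)) -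
    Complex.log ((γ b - x) / (c - x))

theorem exp_closedVar {γ : ℝ → ℂ} {a b r : ℝ} {c x : ℂ} (hab : a ≤ b) (hr : 0 ≤ r)
    (hγ : ContinuousOn γ (Icc a b)) (hx : x ∉ γ '' Icc a b) (hxc : x ∉ Metric.closedBall c r) :
    Complex.exp (closedVar γ a b c x) = 1 := by
  have hne : ∀ t ∈ Icc a b, γ t - x ≠ 0 := fun t ht h ↦
    hx (sub_eq_zero.1 h ▸ mem_image_of_mem γ ht)
  have hc : c - x ≠ 0 := fun h ↦ hxc (sub_eq_zero.1 h ▸ Metric.mem_closedBall_self hr)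
  have ha := hne a (left_mem_Icc.2 hab)
  have hb := hne b (right_mem_Icc.2 hab)
  rw [closedVar, Complex.exp_sub, Complex.exp_add,
    exp_logVar (f := fun t ↦ γ t - x) hab (hγ.sub continuousOn_const) hne,
    Complex.exp_log (div_ne_zero ha hc),
    Complex.exp_log (div_ne_zero hb hc)]
  field_simp

theorem eventually_closedVar_eq {γ : ℝ → ℂ} {a b r : ℝ} {c x : ℂ} (hab : a ≤ b) (hr : 0 ≤ r)
    (hγ : ContinuousOn γ (Icc a b)) (hx : x ∉ γ '' Icc a b) (hxc : x ∉ Metric.closedBall c r)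
    (ha : γ a ∈ Metric.closedBall c r) (hb : γ b ∈ Metric.closedBall c r) :
    ∀ᶠ z in 𝓝 x, closedVar γ a b c z = closedVar γ a b c x := by
  have hcl : IsClosed (γ '' Icc a b) := (isCompact_Icc.image_of_continuousOn hγ).isClosed
  refine eventually_eq_of_exp_eq_one ?_ (exp_closedVar hab hr hγ hx hxc) ?_
  · exact ((continuousAt_logVar hab hγ hx).add (continuousAt_log_div ha hxc hr)).sub
      (continuousAt_log_div hb hxc hr)
  · filter_upwards [hcl.isOpen_compl.mem_nhds hx,
      Metric.isClosed_closedBall.isOpen_compl.mem_nhds hxc] with z hz hz'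
    exact exp_closedVar hab hr hγ hz hz'

/-- Two disjoint discs, and two arcs of the injective curve `γ`, each going from the first disc
to the second one. -/
structure TwoArcs (γ : ℝ → ℂ) where
  /-- centre of the first disc -/
  c₁ : ℂ
  /-- centre of the second disc -/
  c₂ : ℂ
  /-- radius of both discs -/
  r : ℝ
  /-- initial time of the first arc -/
  a : ℝ
  /-- final time of the first arc -/
  b : ℝ
  /-- initial time of the second arc -/
  a' : ℝ
  /-- final time of the second arc -/
  b' : ℝ
  cont : Continuous γ
  inj : InjOn γ (Ici 0)
  r_pos : 0 < r
  a_nonneg : 0 ≤ a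
  hab : a ≤ b
  hba' : b < a'
  hab' : a' ≤ b'
  disj : Disjoint (Metric.closedBall c₁ r) (Metric.closedBall c₂ r)
  ha : γ a ∈ Metric.closedBall c₁ r
  hb : γ b ∈ Metric.closedBall c₂ r
  ha' : γ a' ∈ Metric.closedBall c₁ r
  hb' : γ b' ∈ Metric.closedBall c₂ r
  avoid : ∀ t ∈ Ioo a b, γ t ∉ Metric.closedBall c₁ r ∪ Metric.closedBall c₂ r
  avoid' : ∀ t ∈ Ioo a' b', γ t ∉ Metric.closedBall c₁ r ∪ Metric.closedBall c₂ r

namespace TwoArcs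

variable {γ : ℝ → ℂ} (T : TwoArcs γ)

/-- The first disc. -/
def D₁ : Set ℂ := Metric.closedBall T.c₁ T.r

/-- The second disc. -/
def D₂ : Set ℂ := Metric.closedBall T.c₂ T.r

/-- The union of the discs and the arcs. -/
def X : Set ℂ := T.D₁ ∪ γ '' Icc T.a T.b ∪ T.D₂ ∪ γ '' Icc T.a' T.b'

/-- The logarithmic variation about `x` of the loop made of the two arcs and of segments in the
two discs. -/
noncomputable def index (x : ℂ) : ℂ :=
  logVar (fun t ↦ γ t - x) T.a T.b - logVar (fun t ↦ γ t - x) T.a' T.b' +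
    (Complex.log ((γ T.a - x) / (T.c₁ - x)) - Complex.log ((γ T.a' - x) / (T.c₁ - x)) -
      (Complex.log ((γ T.b - x) / (T.c₂ - x)) - Complex.log ((γ T.b' - x) / (T.c₂ - x))))

theorem isCompact_arc : IsCompact (γ '' Icc T.a T.b) := isCompact_Icc.image T.cont

theorem isCompact_arc' : IsCompact (γ '' Icc T.a' T.b') := isCompact_Icc.image T.cont

theorem isCompact_X : IsCompact T.X :=
  (((isCompact_closedBall _ _).union T.isCompact_arc).union (isCompact_closedBall _ _)).union
    T.isCompact_arc'

theorem notMem_X {x : ℂ} : x ∉ T.X ↔ x ∉ T.D₁ ∧ x ∉ T.D₂ ∧ x ∉ γ '' Icc T.a T.b ∧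
    x ∉ γ '' Icc T.a' T.b' := by
  simp only [X, mem_union, not_or]
  tauto

theorem exp_index {x : ℂ} (hx : x ∉ T.X) : Complex.exp (T.index x) = 1 := by
  obtain ⟨h1, h2, h3, h4⟩ := T.notMem_X.1 hx
  have hne : ∀ t ∈ Icc T.a T.b, γ t - x ≠ 0 := fun t ht h ↦
    h3 (sub_eq_zero.1 h ▸ mem_image_of_mem γ ht)
  have hne' : ∀ t ∈ Icc T.a' T.b', γ t - x ≠ 0 := fun t ht h ↦
    h4 (sub_eq_zero.1 h ▸ mem_image_of_mem γ ht)
  have hc1 : T.c₁ - x ≠ 0 := fun h ↦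
    h1 (sub_eq_zero.1 h ▸ Metric.mem_closedBall_self T.r_pos.le)
  have hc2 : T.c₂ - x ≠ 0 := fun h ↦
    h2 (sub_eq_zero.1 h ▸ Metric.mem_closedBall_self T.r_pos.le)
  have ha := hne _ (left_mem_Icc.2 T.hab)
  have hb := hne _ (right_mem_Icc.2 T.hab)
  have ha' := hne' _ (left_mem_Icc.2 T.hab')
  have hb' := hne' _ (right_mem_Icc.2 T.hab')
  have hcont : Continuous fun t ↦ γ t - x := T.cont.sub continuous_const
  simp only [index, Complex.exp_add, Complex.exp_sub]
  rw [exp_logVar T.hab hcont.continuousOn hne, exp_logVar T.hab' hcont.continuousOn hne',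
    Complex.exp_log (div_ne_zero ha hc1), Complex.exp_log (div_ne_zero ha' hc1),
    Complex.exp_log (div_ne_zero hb hc2), Complex.exp_log (div_ne_zero hb' hc2)]
  field_simp

theorem eventually_index_eq {x : ℂ} (hx : x ∉ T.X) : ∀ᶠ z in 𝓝 x, T.index z = T.index x := by
  obtain ⟨h1, h2, h3, h4⟩ := T.notMem_X.1 hx
  refine eventually_eq_of_exp_eq_one ?_ (T.exp_index hx) ?_
  · exact ((continuousAt_logVar T.hab T.cont.continuousOn h3).sub
      (continuousAt_logVar T.hab' T.cont.continuousOn h4)).add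
      (((continuousAt_log_div T.ha h1 T.r_pos.le).sub
        (continuousAt_log_div T.ha' h1 T.r_pos.le)).sub
      ((continuousAt_log_div T.hb h2 T.r_pos.le).sub
        (continuousAt_log_div T.hb' h2 T.r_pos.le)))
  · filter_upwards [T.isCompact_X.isClosed.isOpen_compl.mem_nhds hx] with z hz
    exact T.exp_index hz

theorem index_eq_sub {x : ℂ} (hx : x ∉ γ '' Icc T.a T.b') :
    T.index x = closedVar γ T.a T.a' T.c₁ x - closedVar γ T.b T.b' T.c₂ x := by
  have hcont : Continuous fun t ↦ γ t - x := T.cont.sub continuous_const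
  have hne : ∀ t ∈ Icc T.a T.b', γ t - x ≠ 0 := fun t ht h ↦
    hx (sub_eq_zero.1 h ▸ mem_image_of_mem γ ht)
  have h1 := logVar_add T.hab T.hba'.le hcont.continuousOn
    (fun t ht ↦ hne t ⟨ht.1, ht.2.trans T.hab'⟩)
  have h2 := logVar_add T.hba'.le T.hab' hcont.continuousOn
    (fun t ht ↦ hne t ⟨T.hab.trans ht.1, ht.2⟩)
  rw [index, closedVar, closedVar, ← h1, ← h2]
  ring

/-- The index vanishes at the points with respect to which the arcs and the discs look small. -/
theorem index_eq_zero_of_far {x p : ℂ} (hx : x ∉ T.X) (hpx : p ≠ x)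
    (h : ∀ z ∈ T.X, ‖z - p‖ ≤ ‖p - x‖ / 40) : T.index x = 0 := by
  refine eq_of_exp_eq_one_of_norm_sub_lt (T.exp_index hx) Complex.exp_zero ?_
  have hpos : 0 < ‖p - x‖ := norm_pos_iff.2 (sub_ne_zero.2 hpx)
  have hV := norm_logVar_sub_const_le (κ := 1 / 40) T.hab T.cont.continuousOn hpx (by norm_num)
    (fun t ht ↦ by
      have := h _ (Or.inl (Or.inl (Or.inr (mem_image_of_mem γ ht))))
      linarith)
  have hV' := norm_logVar_sub_const_le (κ := 1 / 40) T.hab' T.cont.continuousOn hpx (by norm_num)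
    (fun t ht ↦ by
      have := h _ (Or.inr (mem_image_of_mem γ ht))
      linarith)
  have key : ∀ q c : ℂ, q ∈ T.X → c ∈ T.X →
      ‖Complex.log ((q - x) / (c - x))‖ ≤ 3 / 2 * (1 / 18) := by
    intro q c hq hc
    have h1 := h q hq
    have h2 := h c hc
    have h3 : ‖q - c‖ ≤ ‖p - x‖ / 20 := by
      have := norm_sub_le (q - p) (c - p)
      rw [sub_sub_sub_cancel_right] at this
      linarith
    have h4 : ‖p - x‖ * (39 / 40) ≤ ‖c - x‖ := by
      have := norm_sub_le (c - x) (c - p)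
      rw [sub_sub_sub_cancel_left] at this
      linarith
    refine norm_log_div_le (fun hcx ↦ ?_) (by norm_num) (by linarith)
    rw [hcx, sub_self, norm_zero] at h4
    linarith
  have m1 : T.c₁ ∈ T.X := Or.inl (Or.inl (Or.inl (Metric.mem_closedBall_self T.r_pos.le)))
  have m2 : T.c₂ ∈ T.X := Or.inl (Or.inr (Metric.mem_closedBall_self T.r_pos.le))
  have k1 := key _ _ (Or.inl (Or.inl (Or.inl T.ha))) m1
  have k2 := key _ _ (Or.inl (Or.inl (Or.inl T.ha'))) m1
  have k3 := key _ _ (Or.inl (Or.inr T.hb)) m2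
  have k4 := key _ _ (Or.inl (Or.inr T.hb')) m2
  rw [sub_zero, index]
  refine (norm_add_le _ _).trans_lt ?_
  have e1 := norm_sub_le (logVar (fun t ↦ γ t - x) T.a T.b) (logVar (fun t ↦ γ t - x) T.a' T.b')
  have e2 := norm_sub_le (Complex.log ((γ T.a - x) / (T.c₁ - x)))
    (Complex.log ((γ T.a' - x) / (T.c₁ - x)))
  have e3 := norm_sub_le (Complex.log ((γ T.b - x) / (T.c₂ - x)))
    (Complex.log ((γ T.b' - x) / (T.c₂ - x)))
  have e4 := norm_sub_le (Complex.log ((γ T.a - x) / (T.c₁ - x)) -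
    Complex.log ((γ T.a' - x) / (T.c₁ - x))) (Complex.log ((γ T.b - x) / (T.c₂ - x)) -
    Complex.log ((γ T.b' - x) / (T.c₂ - x)))
  linarith

theorem exists_index_eq_zero : ∃ R : ℝ, ∀ x : ℂ, R < ‖x‖ → x ∉ T.X ∧ T.index x = 0 := by
  obtain ⟨M, hM⟩ := T.isCompact_X.isBounded.exists_norm_le
  refine ⟨40 * max M 0, fun x hx ↦ ?_⟩
  have h0 := le_max_right M 0
  have hxX : x ∉ T.X := fun h ↦ by
    have := (hM x h).trans (le_max_left M 0)
    linarith
  refine ⟨hxX, T.index_eq_zero_of_far (p := 0) hxX ?_ fun z hz ↦ ?_⟩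
  · rintro rfl
    rw [norm_zero] at hx
    linarith
  · have := (hM z hz).trans (le_max_left M 0)
    simp only [sub_zero, zero_sub, norm_neg]
    linarith

end TwoArcs

/-! ### Two nonzero values of the index coincide -/

theorem exists_glue {X Y : Type*} [TopologicalSpace X] [TopologicalSpace Y] {s t : Set X}
    (hs : IsClosed s) (ht : IsClosed t) {f g : X → Y} (hf : ContinuousOn f s)
    (hg : ContinuousOn g t) (h : EqOn f g (s ∩ t)) :
    ∃ k : X → Y, ContinuousOn k (s ∪ t) ∧ EqOn k f s ∧ EqOn k g t := by
  classical
  have h1 : EqOn (s.piecewise f g) f s := fun x hx ↦ piecewise_eq_of_mem _ _ _ hx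
  have h2 : EqOn (s.piecewise f g) g t := fun x hx ↦ by
    by_cases hxs : x ∈ s
    · rw [h1 hxs, h ⟨hxs, hx⟩]
    · exact piecewise_eq_of_notMem _ _ _ hxs
  exact ⟨_, (hf.congr h1).union_of_isClosed (hg.congr h2) hs ht, h1, h2⟩

/-- A continuous function of the parameter of an injective arc extends to the plane. -/
theorem exists_extend_arc {γ : ℝ → ℂ} {a b : ℝ} (hγ : ContinuousOn γ (Icc a b))
    (hinj : InjOn γ (Icc a b)) {G : ℝ → ℂ} (hG : ContinuousOn G (Icc a b)) :
    ∃ g : ℂ → ℂ, Continuous g ∧ ∀ t ∈ Icc a b, g (γ t) = G t := by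
  have he : IsClosedEmbedding ((Icc a b).domRestrict γ) :=
    (continuousOn_iff_continuous_domRestrict.1 hγ).isClosedEmbedding (injOn_iff_injective.1 hinj)
  obtain ⟨g, hg⟩ := ContinuousMap.exists_extension he
    ⟨(Icc a b).domRestrict G, continuousOn_iff_continuous_domRestrict.1 hG⟩
  exact ⟨g, g.continuous, fun t ht ↦ DFunLike.congr_fun hg ⟨t, ht⟩⟩

/-- If `(z - x) ^ m / (z - y) ^ n` has a continuous logarithm on a compact set `X` which separates
`x` from `y` and `x` from infinity, then `m = 0`. -/
theorem eq_zero_of_exists_log {X C : Set ℂ} {x y : ℂ} {m n : ℤ} {g : ℂ → ℂ} (hX : IsCompact X)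
    (hC : IsOpen C) (hcl : closure C ⊆ C ∪ X) (hb : Bornology.IsBounded C)
    (hx : x ∈ C) (hy : y ∉ C) (hyX : y ∉ X) (hg : ContinuousOn g X)
    (hexp : ∀ z ∈ X, Complex.exp (g z) = (z - x) ^ m / (z - y) ^ n) : m = 0 := by
  obtain ⟨g', hg'⟩ := ContinuousMap.exists_restrict_eq hX.isClosed
    ⟨X.domRestrict g, continuousOn_iff_continuous_domRestrict.1 hg⟩
  have hgg : ∀ z ∈ X, g' z = g z := fun z hz ↦ DFunLike.congr_fun hg' ⟨z, hz⟩
  have hclosed : IsClosed (C ∪ X) := by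
    refine isClosed_of_closure_subset ?_
    rw [closure_union, hX.isClosed.closure_eq]
    exact union_subset hcl subset_union_right
  have hyne : ∀ z ∈ C ∪ X, z - y ≠ 0 := by
    rintro z hz h
    rw [sub_eq_zero.1 h] at hz
    exact hz.elim hy hyX
  have hxne : ∀ z ∈ Cᶜ, z - x ≠ 0 := fun z hz h ↦ hz (sub_eq_zero.1 h ▸ hx)
  obtain ⟨H, hHc, hH1, hH2⟩ := exists_glue (f := fun z ↦ (z - y) ^ n * Complex.exp (g' z))
    (g := fun z ↦ (z - x) ^ m) hclosed hC.isClosed_compl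
    (((continuousOn_id.sub continuousOn_const).zpow₀ n fun z hz ↦ Or.inl (hyne z hz)).mul
      (Complex.continuous_exp.comp g'.continuous).continuousOn)
    ((continuousOn_id.sub continuousOn_const).zpow₀ m fun z hz ↦ Or.inl (hxne z hz))
    (by
      rintro z ⟨hz1, hz2⟩
      have hzX : z ∈ X := hz1.resolve_left hz2
      simp only
      rw [hgg z hzX, hexp z hzX, mul_div_cancel₀ _ (zpow_ne_zero _ (hyne z hz1))])
  have huniv : C ∪ X ∪ Cᶜ = univ := by
    rw [union_right_comm, union_compl_self, univ_union]
  rw [huniv, continuousOn_univ] at hHc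
  have hH0 : ∀ z, H z ≠ 0 := by
    intro z
    by_cases hz : z ∈ C
    · rw [hH1 (Or.inl hz)]
      exact mul_ne_zero (zpow_ne_zero _ (hyne z (Or.inl hz))) (Complex.exp_ne_zero _)
    · rw [hH2 hz]
      exact zpow_ne_zero _ (hxne z hz)
  obtain ⟨l, hl, hlH⟩ := exists_continuous_log hHc hH0
  obtain ⟨R, hR0, hR⟩ := hb.subset_ball_lt 0 x
  set c : ℝ → ℂ := fun t ↦ x + Complex.exp (Real.log R + t * Complex.I) with hc
  have hcc : Continuous c := by fun_prop
  have hcR : ∀ t, c t ∉ C := by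
    intro t ht
    have := hR ht
    simp only [hc, Metric.mem_ball, dist_eq_norm, add_sub_cancel_left, Complex.norm_exp] at this
    simp [Real.exp_log hR0] at this
  have e1 : IsLogOn (fun t ↦ l (c t)) (fun t ↦ H (c t)) 0 (2 * Real.pi) :=
    ⟨(hl.comp hcc).continuousOn, fun t _ ↦ hlH _⟩
  have e2 : IsLogOn (fun t ↦ m * (Real.log R + t * Complex.I)) (fun t ↦ H (c t))
      0 (2 * Real.pi) := by
    refine ⟨by fun_prop, fun t _ ↦ ?_⟩
    simp only
    rw [hH2 (hcR t), Complex.exp_int_mul]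
    simp [hc]
  have h2π : (0 : ℝ) ≤ 2 * Real.pi := by positivity
  have h3 := (e1.logVar_eq h2π).symm.trans (e2.logVar_eq h2π)
  have h4 : c (2 * Real.pi) = c 0 := by
    simp only [hc]
    push_cast
    rw [Complex.exp_add, Complex.exp_two_pi_mul_I, mul_one, zero_mul, add_zero]
  rw [h4, sub_self] at h3
  have h5 : (m : ℂ) * (2 * Real.pi * Complex.I) = 0 := by
    push_cast at h3
    linear_combination -h3
  rcases mul_eq_zero.1 h5 with h | h
  · exact_mod_cast h
  · exact absurd h Complex.two_pi_I_ne_zero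

namespace TwoArcs

variable {γ : ℝ → ℂ} (T : TwoArcs γ)

theorem D₁_inter_arc : T.D₁ ∩ γ '' Icc T.a T.b ⊆ {γ T.a} := by
  rintro _ ⟨h1, t, ht, rfl⟩
  rcases eq_or_lt_of_le ht.1 with h | h
  · rw [h]; rfl
  rcases eq_or_lt_of_le ht.2 with h' | h'
  · exact absurd T.hb (disjoint_left.1 T.disj (h' ▸ h1))
  · exact absurd (Or.inl h1) (T.avoid t ⟨h, h'⟩)

theorem arc_inter_D₂ : γ '' Icc T.a T.b ∩ T.D₂ ⊆ {γ T.b} := by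
  rintro _ ⟨⟨t, ht, rfl⟩, h1⟩
  rcases eq_or_lt_of_le ht.2 with h | h
  · rw [h]; rfl
  rcases eq_or_lt_of_le ht.1 with h' | h'
  · exact absurd h1 (disjoint_left.1 T.disj (h' ▸ T.ha))
  · exact absurd (Or.inr h1) (T.avoid t ⟨h', h⟩)

theorem D₁_inter_arc' : T.D₁ ∩ γ '' Icc T.a' T.b' ⊆ {γ T.a'} := by
  rintro _ ⟨h1, t, ht, rfl⟩
  rcases eq_or_lt_of_le ht.1 with h | h
  · rw [h]; rfl
  rcases eq_or_lt_of_le ht.2 with h' | h'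
  · exact absurd T.hb' (disjoint_left.1 T.disj (h' ▸ h1))
  · exact absurd (Or.inl h1) (T.avoid' t ⟨h, h'⟩)

theorem D₂_inter_arc' : T.D₂ ∩ γ '' Icc T.a' T.b' ⊆ {γ T.b'} := by
  rintro _ ⟨h1, t, ht, rfl⟩
  rcases eq_or_lt_of_le ht.2 with h | h
  · rw [h]; rfl
  rcases eq_or_lt_of_le ht.1 with h' | h'
  · exact absurd h1 (disjoint_left.1 T.disj (h' ▸ T.ha'))
  · exact absurd (Or.inr h1) (T.avoid' t ⟨h', h⟩)

theorem disjoint_arcs : Disjoint (γ '' Icc T.a T.b) (γ '' Icc T.a' T.b') := by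
  rw [disjoint_left]
  rintro _ ⟨t, ht, rfl⟩ ⟨s, hs, hst⟩
  have h0 := T.a_nonneg
  have h1 := T.hab
  have h2 := T.hba'
  have := T.inj (show 0 ≤ s by linarith [hs.1]) (show 0 ≤ t by linarith [ht.1]) hst
  linarith [ht.2, hs.1]

/-- Continuous functions on the two discs and on the two arcs which agree at the end points of
the arcs glue to a continuous function on the union. -/
theorem exists_glue_X {A₁ A₂ : ℂ → ℂ} {G G' : ℝ → ℂ} (hA₁ : ContinuousOn A₁ T.D₁)
    (hA₂ : ContinuousOn A₂ T.D₂) (hG : ContinuousOn G (Icc T.a T.b))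
    (hG' : ContinuousOn G' (Icc T.a' T.b')) (h1 : A₁ (γ T.a) = G T.a) (h2 : G T.b = A₂ (γ T.b))
    (h3 : A₁ (γ T.a') = G' T.a') (h4 : A₂ (γ T.b') = G' T.b') :
    ∃ g : ℂ → ℂ, ContinuousOn g T.X ∧ EqOn g A₁ T.D₁ ∧ EqOn g A₂ T.D₂ ∧
      (∀ t ∈ Icc T.a T.b, g (γ t) = G t) ∧ ∀ t ∈ Icc T.a' T.b', g (γ t) = G' t := by
  have hsub : Icc T.a T.b ⊆ Ici 0 := fun t ht ↦ T.a_nonneg.trans ht.1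
  have hsub' : Icc T.a' T.b' ⊆ Ici 0 := fun t ht ↦
    (T.a_nonneg.trans T.hab).trans (T.hba'.le.trans ht.1)
  obtain ⟨g1, hg1, hg1G⟩ := exists_extend_arc T.cont.continuousOn (T.inj.mono hsub) hG
  obtain ⟨g2, hg2, hg2G⟩ := exists_extend_arc T.cont.continuousOn (T.inj.mono hsub') hG'
  have hD1 : IsClosed T.D₁ := Metric.isClosed_closedBall
  have hD2 : IsClosed T.D₂ := Metric.isClosed_closedBall
  have ma := left_mem_Icc.2 T.hab
  have mb := right_mem_Icc.2 T.hab
  have ma' := left_mem_Icc.2 T.hab'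
  have mb' := right_mem_Icc.2 T.hab'
  obtain ⟨k1, hk1, k1A, k1G⟩ := exists_glue hD1 T.isCompact_arc.isClosed hA₁ hg1.continuousOn
    (by
      intro z hz
      rw [T.D₁_inter_arc hz, hg1G _ ma, h1])
  obtain ⟨k2, hk2, k2k, k2A⟩ := exists_glue (hD1.union T.isCompact_arc.isClosed) hD2 hk1 hA₂
    (by
      rintro z ⟨hz1 | hz1, hz2⟩
      · exact absurd hz2 (disjoint_left.1 T.disj hz1)
      · rw [T.arc_inter_D₂ ⟨hz1, hz2⟩, k1G (mem_image_of_mem γ mb), hg1G _ mb, h2])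
  obtain ⟨k3, hk3, k3k, k3G⟩ := exists_glue ((hD1.union T.isCompact_arc.isClosed).union hD2)
    T.isCompact_arc'.isClosed hk2 hg2.continuousOn
    (by
      rintro z ⟨(hz1 | hz1) | hz1, hz2⟩
      · rw [T.D₁_inter_arc' ⟨hz1, hz2⟩, k2k (Or.inl T.ha'), k1A T.ha', h3, hg2G _ ma']
      · exact absurd hz2 (disjoint_left.1 T.disjoint_arcs hz1)
      · rw [T.D₂_inter_arc' ⟨hz1, hz2⟩, k2A T.hb', h4, hg2G _ mb'])
  refine ⟨k3, hk3, fun z hz ↦ ?_, fun z hz ↦ ?_, fun t ht ↦ ?_, fun t ht ↦ ?_⟩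
  · rw [k3k (Or.inl (Or.inl hz)), k2k (Or.inl hz), k1A hz]
  · rw [k3k (Or.inr hz), k2A hz]
  · have := mem_image_of_mem γ ht
    rw [k3k (Or.inl (Or.inr this)), k2k (Or.inr this), k1G this, hg1G _ ht]
  · rw [k3G (mem_image_of_mem γ ht), hg2G _ ht]

theorem exists_isLogOn_zpow {γ : ℝ → ℂ} (hγ : Continuous γ) {a b : ℝ} (hab : a ≤ b) {x y : ℂ}
    (hx : x ∉ γ '' Icc a b) (hy : y ∉ γ '' Icc a b) (m n : ℤ) :
    ∃ G : ℝ → ℂ, IsLogOn G (fun t ↦ (γ t - x) ^ m / (γ t - y) ^ n) a b ∧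
      G b - G a = m * logVar (fun t ↦ γ t - x) a b - n * logVar (fun t ↦ γ t - y) a b := by
  have key : ∀ z, z ∉ γ '' Icc a b → ∃ G, IsLogOn G (fun t ↦ γ t - z) a b := fun z hz ↦
    exists_isLogOn hab (hγ.sub continuous_const).continuousOn fun t ht h ↦
      hz (sub_eq_zero.1 h ▸ mem_image_of_mem γ ht)
  obtain ⟨P, hP⟩ := key x hx
  obtain ⟨Q, hQ⟩ := key y hy
  refine ⟨fun t ↦ m * P t - n * Q t, ⟨?_, fun t ht ↦ ?_⟩, ?_⟩
  · exact (continuousOn_const.mul hP.1).sub (continuousOn_const.mul hQ.1)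
  · rw [Complex.exp_sub, Complex.exp_int_mul, Complex.exp_int_mul, hP.2 t ht, hQ.2 t ht]
  · rw [hP.logVar_eq hab, hQ.logVar_eq hab]
    ring

theorem exists_log_zpow_closedBall {c x y : ℂ} {r : ℝ} (hr : 0 ≤ r)
    (hx : x ∉ Metric.closedBall c r) (hy : y ∉ Metric.closedBall c r) (m n : ℤ) :
    ∃ A : ℂ → ℂ, ContinuousOn A (Metric.closedBall c r) ∧
      (∀ z ∈ Metric.closedBall c r, ∀ z' ∈ Metric.closedBall c r,
        Complex.exp (A z - A z') = ((z - x) ^ m / (z - y) ^ n) / ((z' - x) ^ m / (z' - y) ^ n)) ∧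
      ∀ z, A z = m * Complex.log ((z - x) / (c - x)) - n * Complex.log ((z - y) / (c - y)) := by
  have hne : ∀ w, w ∉ Metric.closedBall c r → ∀ z ∈ Metric.closedBall c r, z - w ≠ 0 :=
    fun w hw z hz h ↦ hw (sub_eq_zero.1 h ▸ hz)
  have hcm := Metric.mem_closedBall_self (x := c) hr
  refine ⟨_, ?_, ?_, fun z ↦ rfl⟩
  · have key : ∀ w, w ∉ Metric.closedBall c r →
        ContinuousOn (fun z ↦ Complex.log ((z - w) / (c - w))) (Metric.closedBall c r) :=
      fun w hw ↦ ((continuousOn_id.sub continuousOn_const).div_const _).clog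
        fun z hz ↦ div_mem_slitPlane hz hw
    exact (continuousOn_const.mul (key x hx)).sub (continuousOn_const.mul (key y hy))
  · intro z hz z' hz'
    have h1 := hne x hx z hz
    have h2 := hne x hx z' hz'
    have h3 := hne y hy z hz
    have h4 := hne y hy z' hz'
    have h5 := hne x hx c hcm
    have h6 := hne y hy c hcm
    simp only [Complex.exp_sub, Complex.exp_int_mul]
    rw [Complex.exp_log (div_ne_zero h1 h5), Complex.exp_log (div_ne_zero h2 h5),
      Complex.exp_log (div_ne_zero h3 h6), Complex.exp_log (div_ne_zero h4 h6)]
    simp only [div_zpow]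
    have k1 := zpow_ne_zero m h1
    have k2 := zpow_ne_zero m h2
    have k3 := zpow_ne_zero n h3
    have k4 := zpow_ne_zero n h4
    have k5 := zpow_ne_zero m h5
    have k6 := zpow_ne_zero n h6
    field_simp

theorem index_eq_of_ne_zero {x y : ℂ} (hx : x ∉ T.X) (hy : y ∉ T.X) (hx0 : T.index x ≠ 0)
    (hy0 : T.index y ≠ 0) : T.index x = T.index y := by
  by_contra hne
  obtain ⟨n, hn⟩ := Complex.exp_eq_one_iff.1 (T.exp_index hx)
  obtain ⟨m, hm⟩ := Complex.exp_eq_one_iff.1 (T.exp_index hy)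
  have hrel : m * T.index x - n * T.index y = 0 := by
    rw [hn, hm]; ring
  obtain ⟨hx1, hx2, hx3, hx4⟩ := T.notMem_X.1 hx
  obtain ⟨hy1, hy2, hy3, hy4⟩ := T.notMem_X.1 hy
  obtain ⟨A₁, hA₁, hA₁e, hA₁d⟩ := exists_log_zpow_closedBall T.r_pos.le hx1 hy1 m n
  obtain ⟨A₂, hA₂, hA₂e, hA₂d⟩ := exists_log_zpow_closedBall T.r_pos.le hx2 hy2 m n
  obtain ⟨G, hG, hGd⟩ := exists_isLogOn_zpow T.cont T.hab hx3 hy3 m n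
  obtain ⟨G', hG', hGd'⟩ := exists_isLogOn_zpow T.cont T.hab' hx4 hy4 m n
  set f : ℂ → ℂ := fun z ↦ (z - x) ^ m / (z - y) ^ n with hf
  have hf0 : ∀ z ∈ T.X, f z ≠ 0 := fun z hz ↦ div_ne_zero
    (zpow_ne_zero _ fun h ↦ hx (sub_eq_zero.1 h ▸ hz))
    (zpow_ne_zero _ fun h ↦ hy (sub_eq_zero.1 h ▸ hz))
  have ma := left_mem_Icc.2 T.hab
  have mb := right_mem_Icc.2 T.hab
  have ma' := left_mem_Icc.2 T.hab'
  have mb' := right_mem_Icc.2 T.hab'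
  have m1 : T.D₁ ⊆ T.X := fun z hz ↦ Or.inl (Or.inl (Or.inl hz))
  have m2 : T.D₂ ⊆ T.X := fun z hz ↦ Or.inl (Or.inr hz)
  obtain ⟨g, hg, hg1, hg2, hg3, hg4⟩ := T.exists_glue_X
    (A₁ := fun z ↦ A₁ z - A₁ (γ T.a) + G T.a) (A₂ := fun z ↦ A₂ z - A₂ (γ T.b) + G T.b) (G := G)
    (G' := fun t ↦ G' t - G' T.a' + (A₁ (γ T.a') - A₁ (γ T.a) + G T.a))
    ((hA₁.sub continuousOn_const).add continuousOn_const)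
    ((hA₂.sub continuousOn_const).add continuousOn_const) hG.1
    ((hG'.1.sub continuousOn_const).add continuousOn_const) (by ring) (by ring) (by ring) (by
      simp only [hA₁d, hA₂d]
      simp only [index] at hrel
      linear_combination hrel + hGd - hGd')
  have hexp : ∀ z ∈ T.X, Complex.exp (g z) = f z := by
    have hA1' : ∀ z ∈ T.D₁, Complex.exp (A₁ z - A₁ (γ T.a) + G T.a) = f z := by
      intro z hz
      rw [Complex.exp_add, hA₁e _ hz _ T.ha, hG.2 _ ma]
      exact div_mul_cancel₀ _ (hf0 _ (m1 T.ha))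
    rintro z (((hz | ⟨t, ht, rfl⟩) | hz) | ⟨t, ht, rfl⟩)
    · rw [hg1 hz]
      exact hA1' z hz
    · rw [hg3 t ht, hG.2 t ht]
    · rw [hg2 hz]
      simp only
      rw [Complex.exp_add, hA₂e _ hz _ T.hb, hG.2 _ mb]
      exact div_mul_cancel₀ _ (hf0 _ (m2 T.hb))
    · rw [hg4 t ht, Complex.exp_add, hA1' _ T.ha', Complex.exp_sub, hG'.2 _ ht, hG'.2 _ ma']
      exact div_mul_cancel₀ _ (hf0 _ (m1 T.ha'))
  obtain ⟨R, hR⟩ := T.exists_index_eq_zero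
  have hm0 : m = 0 := by
    refine eq_zero_of_exists_log (C := {z | z ∉ T.X ∧ T.index z = T.index x}) (n := n)
      T.isCompact_X ?_ ?_ ?_ ⟨hx, rfl⟩ (fun h ↦ hne h.2.symm) hy hg hexp
    · rw [isOpen_iff_mem_nhds]
      rintro z ⟨hz, hzi⟩
      filter_upwards [T.isCompact_X.isClosed.isOpen_compl.mem_nhds hz,
        T.eventually_index_eq hz] with w hw hwi
      exact ⟨hw, hwi.trans hzi⟩
    · intro z hz
      by_cases hzX : z ∈ T.X
      · exact Or.inr hzX
      · obtain ⟨w, hw, hwC⟩ := ((mem_closure_iff_frequently.1 hz).and_eventually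
          (T.eventually_index_eq hzX)).exists
        exact Or.inl ⟨hzX, hwC ▸ hw.2⟩
    · refine (Metric.isBounded_closedBall (x := (0 : ℂ)) (r := R)).subset fun z hz ↦ ?_
      rw [mem_closedBall_zero_iff]
      by_contra! h
      exact hx0 (hz.2 ▸ (hR z h).2)
  rw [hm0] at hm
  exact hy0 (by simpa using hm)

end TwoArcs

/-! ### Recurrent points have index zero -/

theorem monotoneOn_Ioi_of_eventually {F : ℝ → ℝ} {b : ℝ}
    (h : ∀ t > b, ∀ᶠ s in 𝓝 t, (s ≤ t → F s ≤ F t) ∧ (t ≤ s → F t ≤ F s)) :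
    MonotoneOn F (Ioi b) := by
  intro x hx y hy hxy
  set S : Set ℝ := {s | s ∈ Icc x y ∧ F x ≤ F s} with hS
  have hxS : x ∈ S := ⟨left_mem_Icc.2 hxy, le_rfl⟩
  have hbdd : BddAbove S := ⟨y, fun s hs ↦ hs.1.2⟩
  set c := sSup S with hc
  have hxc : x ≤ c := le_csSup hbdd hxS
  have hcy : c ≤ y := csSup_le ⟨x, hxS⟩ fun s hs ↦ hs.1.2
  obtain ⟨ε, hε, hball⟩ := Metric.eventually_nhds_iff.1 (h c (lt_of_lt_of_le hx hxc))
  obtain ⟨s, hs, hsc⟩ := exists_lt_of_lt_csSup ⟨x, hxS⟩ (show c - ε < c by linarith)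
  have hsc' : s ≤ c := le_csSup hbdd hs
  have hFc : F x ≤ F c := hs.2.trans ((hball (by
    rw [Real.dist_eq, abs_sub_comm, abs_of_nonneg] <;> linarith)).1 hsc')
  rcases eq_or_lt_of_le hcy with h1 | h1
  · rwa [h1] at hFc
  · exfalso
    have hlt : c < min y (c + ε / 2) := lt_min h1 (by linarith)
    have hm : min y (c + ε / 2) ∈ S := by
      refine ⟨⟨hxc.trans hlt.le, min_le_left _ _⟩, hFc.trans ((hball ?_).2 hlt.le)⟩
      rw [Real.dist_eq, abs_of_nonneg (by linarith)]
      have := min_le_right y (c + ε / 2)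
      linarith
    exact absurd (le_csSup hbdd hm) (not_le.2 hlt)

/-- The piecewise affine function which is `0` before `k₁`, and `1` after `k₂`. -/
noncomputable def ramp (k₁ k₂ s : ℝ) : ℝ := max 0 (min 1 ((s - k₁) / (k₂ - k₁)))

theorem continuous_ramp (k₁ k₂ : ℝ) : Continuous (ramp k₁ k₂) := by
  unfold ramp
  fun_prop

theorem ramp_of_le {k₁ k₂ s : ℝ} (hk : k₁ < k₂) (h : s ≤ k₁) : ramp k₁ k₂ s = 0 := by
  refine max_eq_left ((min_le_right _ _).trans (div_nonpos_of_nonpos_of_nonneg ?_ ?_)) <;> linarith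

theorem ramp_of_ge {k₁ k₂ s : ℝ} (hk : k₁ < k₂) (h : k₂ ≤ s) : ramp k₁ k₂ s = 1 := by
  rw [ramp, min_eq_left, max_eq_right zero_le_one]
  rw [le_div_iff₀ (by linarith)]
  linarith

theorem ramp_of_mem {k₁ k₂ s : ℝ} (h : s ∈ Icc k₁ k₂) (hk : k₁ < k₂) :
    ramp k₁ k₂ s = (s - k₁) / (k₂ - k₁) := by
  rw [ramp, min_eq_right, max_eq_right]
  · exact div_nonneg (by linarith [h.1]) (by linarith)
  · rw [div_le_one (by linarith)]
    linarith [h.2]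

theorem monotone_ramp {k₁ k₂ : ℝ} (hk : k₁ < k₂) : Monotone (ramp k₁ k₂) := by
  intro x y hxy
  unfold ramp
  have : (x - k₁) / (k₂ - k₁) ≤ (y - k₁) / (k₂ - k₁) :=
    div_le_div_of_nonneg_right (by linarith) (by linarith)
  exact max_le_max_left _ (min_le_min_left _ this)

namespace TwoArcs

variable {γ : ℝ → ℂ} (T : TwoArcs γ)

theorem notMem_image_of_lt {t : ℝ} (ht : T.b' < t) : γ t ∉ γ '' Icc T.a T.b' := by
  rintro ⟨s, hs, hst⟩
  have h0 := T.a_nonneg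
  have h1 := T.hab
  have h2 := T.hba'
  have h3 := T.hab'
  have := T.inj (show 0 ≤ s by linarith [hs.1]) (show 0 ≤ t by linarith) hst
  linarith [hs.2]

theorem notMem_X_of_lt {t : ℝ} (ht : T.b' < t) (h1 : γ t ∉ T.D₁) (h2 : γ t ∉ T.D₂) :
    γ t ∉ T.X :=
  T.notMem_X.2 ⟨h1, h2,
    fun h ↦ T.notMem_image_of_lt ht (image_mono (Icc_subset_Icc_right (T.hba'.le.trans T.hab')) h),
    fun h ↦ T.notMem_image_of_lt ht (image_mono (Icc_subset_Icc_left (T.hab.trans T.hba'.le)) h)⟩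

theorem im_index_ne_zero {x : ℂ} (hx : x ∉ T.X) (h : T.index x ≠ 0) : (T.index x).im ≠ 0 := by
  obtain ⟨n, hn⟩ := Complex.exp_eq_one_iff.1 (T.exp_index hx)
  rw [hn] at h ⊢
  intro h'
  simp only [Complex.mul_im, Complex.mul_re, Complex.intCast_re, Complex.intCast_im,
    Complex.ofReal_re, Complex.ofReal_im, Complex.I_re, Complex.I_im, Complex.re_ofNat,
    Complex.im_ofNat] at h'
  have hn0 : (n : ℝ) * (2 * Real.pi) = 0 := by linear_combination h'
  rcases mul_eq_zero.1 hn0 with h1 | h1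
  · rw [Int.cast_eq_zero.1 h1] at h
    simp at h
  · linarith [Real.pi_pos]

theorem index_eq_zero_of_recurrent {u : ℝ → ℝ} (hu : Continuous u) {k₁ k₂ θ : ℝ} (hk : k₁ < k₂)
    (hu1 : ∀ t, 0 ≤ t → γ t ∈ T.D₁ → u t < k₁) (hu2 : ∀ t, 0 ≤ t → γ t ∈ T.D₂ → k₂ < u t)
    (hmono : ∀ t, T.b' < t → γ t ∉ T.X → T.index (γ t) ≠ 0 →
      ∀ᶠ s in 𝓝 t, (s < t → u s < u t) ∧ (t < s → u t < u s))
    (hθ : T.b' < θ) (hθ1 : k₁ < u θ) (hθ2 : u θ < k₂) {τ : ℕ → ℝ} (hτ : Tendsto τ atTop atTop)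
    (hγτ : Tendsto (fun n ↦ γ (τ n)) atTop (𝓝 (γ θ)))
    (huτ : Tendsto (fun n ↦ u (τ n)) atTop (𝓝 (u θ))) : T.index (γ θ) = 0 := by
  by_contra hne
  have hb0 : 0 ≤ T.b' := T.a_nonneg.trans (T.hab.trans (T.hba'.le.trans T.hab'))
  have nD1 : ∀ t, T.b' < t → k₁ < u t → γ t ∉ T.D₁ := fun t ht h h' ↦
    absurd (hu1 t (by linarith) h') (by linarith)
  have nD2 : ∀ t, T.b' < t → u t < k₂ → γ t ∉ T.D₂ := fun t ht h h' ↦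
    absurd (hu2 t (by linarith) h') (by linarith)
  have hθX : γ θ ∉ T.X := T.notMem_X_of_lt hθ (nD1 θ hθ hθ1) (nD2 θ hθ hθ2)
  set W : ℝ := (T.index (γ θ)).im with hW
  have hW0 : W ≠ 0 := T.im_index_ne_zero hθX hne
  set P : ℂ → ℝ := fun x ↦ (closedVar γ T.b T.b' T.c₂ x).im with hP
  set Q : ℂ → ℝ := fun x ↦ (closedVar γ T.a T.a' T.c₁ x).im with hQ
  set F : ℝ → ℝ := fun t ↦ W * ((1 - ramp k₁ k₂ (u t)) * P (γ t) + ramp k₁ k₂ (u t) * Q (γ t))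
    with hF
  have locP : ∀ t, T.b' < t → γ t ∉ T.D₂ → ∀ᶠ z in 𝓝 (γ t), P z = P (γ t) := by
    intro t ht hD
    filter_upwards [eventually_closedVar_eq (T.hba'.le.trans T.hab') T.r_pos.le T.cont.continuousOn
      (fun h ↦ T.notMem_image_of_lt ht (image_mono (Icc_subset_Icc_left T.hab) h)) hD T.hb T.hb']
      with z hz
    simp only [hP, hz]
  have locQ : ∀ t, T.b' < t → γ t ∉ T.D₁ → ∀ᶠ z in 𝓝 (γ t), Q z = Q (γ t) := by
    intro t ht hD
    filter_upwards [eventually_closedVar_eq (T.hab.trans T.hba'.le) T.r_pos.le T.cont.continuousOn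
      (fun h ↦ T.notMem_image_of_lt ht (image_mono (Icc_subset_Icc_right T.hab') h)) hD T.ha T.ha']
      with z hz
    simp only [hQ, hz]
  have hPQ : ∀ t, T.b' < t → Q (γ t) - P (γ t) = (T.index (γ t)).im := by
    intro t ht
    rw [T.index_eq_sub (T.notMem_image_of_lt ht), Complex.sub_im]
  have hFmono : MonotoneOn F (Ioi T.b') := by
    refine monotoneOn_Ioi_of_eventually fun t ht ↦ ?_
    by_cases h1 : γ t ∈ T.D₁
    · have h2 : γ t ∉ T.D₂ := disjoint_left.1 T.disj h1
      have h3 := hu1 t (hb0.trans (le_of_lt ht)) h1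
      filter_upwards [T.cont.continuousAt.eventually (locP t ht h2),
        hu.continuousAt.eventually_lt_const h3] with s hs hs'
      have : F s = F t := by
        simp only [hF]
        rw [ramp_of_le hk hs'.le, ramp_of_le hk h3.le, hs, zero_mul, zero_mul]
      exact ⟨fun _ ↦ this.le, fun _ ↦ this.ge⟩
    by_cases h2 : γ t ∈ T.D₂
    · have h3 := hu2 t (hb0.trans (le_of_lt ht)) h2
      filter_upwards [T.cont.continuousAt.eventually (locQ t ht h1),
        hu.continuousAt.eventually_const_lt h3] with s hs hs'
      have : F s = F t := by
        simp only [hF]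
        rw [ramp_of_ge hk hs'.le, ramp_of_ge hk h3.le, hs]
        ring
      exact ⟨fun _ ↦ this.le, fun _ ↦ this.ge⟩
    have htX := T.notMem_X_of_lt ht h1 h2
    have hFs : ∀ᶠ s in 𝓝 t, F s - F t =
        W * (T.index (γ t)).im * (ramp k₁ k₂ (u s) - ramp k₁ k₂ (u t)) := by
      filter_upwards [T.cont.continuousAt.eventually (locP t ht h2),
        T.cont.continuousAt.eventually (locQ t ht h1)] with s hs hs'
      simp only [hF]
      rw [hs, hs', ← hPQ t ht]
      ring
    by_cases hi : T.index (γ t) = 0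
    · filter_upwards [hFs] with s hs
      rw [hi, Complex.zero_im, mul_zero, zero_mul, sub_eq_zero] at hs
      exact ⟨fun _ ↦ hs.le, fun _ ↦ hs.ge⟩
    · have hWt : (T.index (γ t)).im = W := by rw [T.index_eq_of_ne_zero htX hθX hi hne]
      filter_upwards [hFs, hmono t ht htX hi] with s hs hs'
      rw [hWt] at hs
      refine ⟨fun hst ↦ ?_, fun hst ↦ ?_⟩
      · rcases eq_or_lt_of_le hst with rfl | hst
        · exact le_rfl
        have := monotone_ramp hk (hs'.1 hst).le
        nlinarith [mul_self_pos.2 hW0]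
      · rcases eq_or_lt_of_le hst with rfl | hst
        · exact le_rfl
        have := monotone_ramp hk (hs'.2 hst).le
        nlinarith [mul_self_pos.2 hW0]
  have hlim : Tendsto (fun n ↦ F (τ n)) atTop (𝓝 (F θ)) := by
    have hr := ((continuous_ramp k₁ k₂).tendsto (u θ)).comp huτ
    have e : ∀ᶠ n in atTop, W * ((1 - ramp k₁ k₂ (u (τ n))) * P (γ θ) +
        ramp k₁ k₂ (u (τ n)) * Q (γ θ)) = F (τ n) := by
      filter_upwards [hγτ.eventually (locP θ hθ (nD2 θ hθ hθ2)),
        hγτ.eventually (locQ θ hθ (nD1 θ hθ hθ1))] with n h1 h2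
      simp only [hF]
      rw [h1, h2]
    refine Tendsto.congr' e ?_
    exact (((tendsto_const_nhds.sub hr).mul_const _).add (hr.mul_const _)).const_mul _
  have hconst : ∀ s, θ < s → F s ≤ F θ := by
    intro s hs
    refine ge_of_tendsto hlim ?_
    filter_upwards [hτ.eventually_ge_atTop s] with n hn
    exact hFmono (hθ.trans hs) ((hθ.trans hs).trans_le hn) hn
  have hFs : ∀ᶠ s in 𝓝 θ, F s - F θ = W * W * (ramp k₁ k₂ (u s) - ramp k₁ k₂ (u θ)) := by
    filter_upwards [T.cont.continuousAt.eventually (locP θ hθ (nD2 θ hθ hθ2)),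
      T.cont.continuousAt.eventually (locQ θ hθ (nD1 θ hθ hθ1))] with s hs hs'
    simp only [hF]
    rw [hs, hs', hW, ← hPQ θ hθ]
    ring
  have hev : ∀ᶠ s in 𝓝 θ, θ < s → False := by
    filter_upwards [hFs, hmono θ hθ hθX hne, hu.continuousAt.eventually_lt_const hθ2]
      with s hs hs' hs2 hlt
    have h1 := hs'.2 hlt
    rw [ramp_of_mem ⟨(hθ1.trans h1).le, hs2.le⟩ hk, ramp_of_mem ⟨hθ1.le, hθ2.le⟩ hk,
      ← sub_div] at hs
    have h2 : 0 < (u s - k₁ - (u θ - k₁)) / (k₂ - k₁) := div_pos (by linarith) (by linarith)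
    have h3 := mul_pos (mul_self_pos.2 hW0) h2
    linarith [hconst s hlt]
  obtain ⟨s, hs, hs'⟩ := ((hev.filter_mono nhdsWithin_le_nhds).and
    (self_mem_nhdsWithin (a := θ) (s := Ioi θ))).exists
  exact hs hs'

end TwoArcs

/-! ### Three parallel arcs -/

/-- For two disjoint curves `g` and `k` close to the injective curve `γ` on `[a, b]`, the sum of
the logarithmic variation of `k` about `g m` and of that of `g` about `k m` is almost the closing
constant of `γ`. -/
theorem norm_logVar_add_logVar_sub_le {γ g k : ℝ → ℂ} {a m b κ : ℝ} (ham : a ≤ m) (hmb : m ≤ b)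
    (hγ : Continuous γ) (hg : Continuous g) (hk : Continuous k) (hκ : κ ≤ 1 / 2)
    (hne : ∀ u ∈ Icc a b, ∀ v ∈ Icc a b, g u ≠ k v)
    (hm1 : ∀ u ∈ Icc m b, γ a ≠ γ u) (hm2 : ∀ u ∈ Icc a m, γ u ≠ γ b)
    (h1 : ∀ u ∈ Icc m b, ∀ p ∈ Icc a b, ∀ q ∈ Icc a b,
      ‖g p - γ p‖ + ‖k q - γ q‖ ≤ κ * ‖γ a - γ u‖)
    (h2 : ∀ u ∈ Icc a m, ∀ p ∈ Icc a b, ∀ q ∈ Icc a b,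
      ‖g p - γ p‖ + ‖k q - γ q‖ ≤ κ * ‖γ u - γ b‖) :
    ‖logVar (fun v ↦ k v - g m) a b + logVar (fun v ↦ g v - k m) a b -
      2 * (logVar (fun u ↦ γ a - γ u) m b + logVar (fun u ↦ γ u - γ b) a m)‖ ≤ 12 * κ := by
  have hab := ham.trans hmb
  have ma := left_mem_Icc.2 hab
  have mb := right_mem_Icc.2 hab
  have mm : m ∈ Icc a b := ⟨ham, hmb⟩
  have s1 : Icc m b ⊆ Icc a b := Icc_subset_Icc_left ham
  have s2 : Icc a m ⊆ Icc a b := Icc_subset_Icc_right hmb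
  have hf : Continuous fun p : ℝ × ℝ ↦ k p.2 - g p.1 := by fun_prop
  have hf0 : ∀ u ∈ Icc a b, ∀ v ∈ Icc a b, k v - g u ≠ 0 := fun u hu v hv ↦
    sub_ne_zero.2 (hne u hu v hv).symm
  have r1 := logVar_rectangle (f := fun u v ↦ k v - g u) hmb ham hf.continuousOn
    fun u hu v hv ↦ hf0 u (s1 hu) v (s2 hv)
  have r2 := logVar_rectangle (f := fun u v ↦ k v - g u) ham hmb hf.continuousOn
    fun u hu v hv ↦ hf0 u (s2 hu) v (s1 hv)
  have cv : ∀ u, Continuous fun v ↦ k v - g u := fun u ↦ by fun_prop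
  have cu : ∀ v, Continuous fun u ↦ k v - g u := fun v ↦ by fun_prop
  have a1 := logVar_add ham hmb (cv m).continuousOn fun v hv ↦ hf0 m mm v hv
  have a2 := logVar_add ham hmb (cu m).continuousOn fun u hu ↦ hf0 u hu m mm
  have n1 : logVar (fun v ↦ g v - k m) a b = logVar (fun u ↦ k m - g u) a b := by
    rw [← logVar_neg hab (cu m).continuousOn fun u hu ↦ hf0 u hu m mm]
    simp only [neg_sub]
  have tri : ∀ p q : ℝ, ‖k q - g p - (γ q - γ p)‖ ≤ ‖g p - γ p‖ + ‖k q - γ q‖ := by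
    intro p q
    have : k q - g p - (γ q - γ p) = (k q - γ q) - (g p - γ p) := by ring
    rw [this, add_comm]
    exact norm_sub_le _ _
  have e1 : ‖logVar (fun u ↦ k a - g u) m b - logVar (fun u ↦ γ a - γ u) m b‖ ≤ 3 * κ :=
    norm_logVar_sub_le hmb (cu a).continuousOn (by fun_prop)
      (fun u hu ↦ sub_ne_zero.2 (hm1 u hu)) hκ
      fun u hu ↦ (tri u a).trans (h1 u hu u (s1 hu) a ma)
  have e2 : ‖logVar (fun v ↦ k v - g a) m b - logVar (fun u ↦ γ a - γ u) m b‖ ≤ 3 * κ := by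
    rw [← logVar_neg (f := fun u ↦ γ a - γ u) hmb (by fun_prop)
      fun u hu ↦ sub_ne_zero.2 (hm1 u hu)]
    simp only [neg_sub]
    refine norm_logVar_sub_le hmb (cv a).continuousOn (by fun_prop)
      (fun u hu ↦ sub_ne_zero.2 (hm1 u hu).symm) hκ fun u hu ↦ (tri a u).trans ?_
    rw [norm_sub_rev (γ u)]
    exact h1 u hu a ma u (s1 hu)
  have e3 : ‖logVar (fun v ↦ k v - g b) a m - logVar (fun u ↦ γ u - γ b) a m‖ ≤ 3 * κ :=
    norm_logVar_sub_le ham (cv b).continuousOn (by fun_prop)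
      (fun u hu ↦ sub_ne_zero.2 (hm2 u hu)) hκ
      fun u hu ↦ (tri b u).trans (h2 u hu b mb u (s2 hu))
  have e4 : ‖logVar (fun u ↦ k b - g u) a m - logVar (fun u ↦ γ u - γ b) a m‖ ≤ 3 * κ := by
    rw [← logVar_neg (f := fun u ↦ γ u - γ b) ham (by fun_prop)
      fun u hu ↦ sub_ne_zero.2 (hm2 u hu)]
    simp only [neg_sub]
    refine norm_logVar_sub_le ham (cu b).continuousOn (by fun_prop)
      (fun u hu ↦ sub_ne_zero.2 (hm2 u hu).symm) hκ fun u hu ↦ (tri u b).trans ?_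
    rw [norm_sub_rev (γ b)]
    exact h2 u hu u (s2 hu) b mb
  have key : logVar (fun v ↦ k v - g m) a b + logVar (fun v ↦ g v - k m) a b -
      2 * (logVar (fun u ↦ γ a - γ u) m b + logVar (fun u ↦ γ u - γ b) a m) =
      (logVar (fun u ↦ k a - g u) m b - logVar (fun u ↦ γ a - γ u) m b) +
      (logVar (fun v ↦ k v - g a) m b - logVar (fun u ↦ γ a - γ u) m b) +
      ((logVar (fun v ↦ k v - g b) a m - logVar (fun u ↦ γ u - γ b) a m) +
      (logVar (fun u ↦ k b - g u) a m - logVar (fun u ↦ γ u - γ b) a m)) := by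
    rw [n1]
    linear_combination r1 - r2 - a1 - a2
  rw [key]
  refine (norm_add_le _ _).trans ?_
  have f1 := norm_add_le (logVar (fun u ↦ k a - g u) m b - logVar (fun u ↦ γ a - γ u) m b)
    (logVar (fun v ↦ k v - g a) m b - logVar (fun u ↦ γ a - γ u) m b)
  have f2 := norm_add_le (logVar (fun v ↦ k v - g b) a m - logVar (fun u ↦ γ u - γ b) a m)
    (logVar (fun u ↦ k b - g u) a m - logVar (fun u ↦ γ u - γ b) a m)
  linarith

theorem norm_div_add_one_le {p q P Q : ℂ} {κ : ℝ} (hκ : κ ≤ 1 / 2) (hP : P ≠ 0) (hQ : Q ≠ 0)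
    (hp : ‖p - P‖ ≤ κ * ‖P‖) (hq : ‖q - Q‖ ≤ κ * ‖Q‖) : ‖(p / q) / (-P / Q) + 1‖ ≤ 4 * κ := by
  have hκ0 : 0 ≤ κ := by
    by_contra! h
    have := norm_pos_iff.2 hP
    nlinarith [norm_nonneg (p - P)]
  have h1 := norm_div_sub_one_le hP hp
  have h2 := norm_div_sub_one_le hQ hq
  have h3 : 1 / 2 ≤ ‖q / Q‖ := by
    have := norm_sub_norm_le 1 (q / Q)
    rw [norm_one, norm_sub_rev] at this
    linarith
  have hqQ : q / Q ≠ 0 := norm_pos_iff.1 (by linarith)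
  have hq0 : q ≠ 0 := fun h ↦ hqQ (by rw [h, zero_div])
  have h4 : (p / q) / (-P / Q) + 1 = ((q / Q - 1) - (p / P - 1)) / (q / Q) := by
    field_simp
    ring
  rw [h4, norm_div, div_le_iff₀ (by linarith)]
  have := norm_sub_le (q / Q - 1) (p / P - 1)
  nlinarith

theorem exists_triple_bound {γ : ℝ → ℂ} {a m b : ℝ} (ham : a < m) (hmb : m < b) (hγ : Continuous γ)
    (hinj : InjOn γ (Icc a b)) : ∃ ε > 0, ∀ g : Fin 3 → ℝ → ℂ, (∀ i, Continuous (g i)) →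
      (∀ i, ∀ t ∈ Icc a b, ‖g i t - γ t‖ ≤ ε) →
      (∀ i j, i ≠ j → ∀ u ∈ Icc a b, ∀ v ∈ Icc a b, g i u ≠ g j v) →
      (∀ i j k, i ≠ j → j ≠ k → i ≠ k →
        ‖logVar (fun v ↦ g j v - g i m) a b - logVar (fun v ↦ g k v - g i m) a b‖ ≤ 1 / 20) →
      False := by
  have hab := ham.trans hmb
  have mm : m ∈ Icc a b := ⟨ham.le, hmb.le⟩
  have ma := left_mem_Icc.2 hab.le
  have mb := right_mem_Icc.2 hab.le
  have hm1 : ∀ u ∈ Icc m b, γ a ≠ γ u := fun u hu h ↦ by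
    have := hinj ma ⟨ham.le.trans hu.1, hu.2⟩ h
    linarith [hu.1]
  have hm2 : ∀ u ∈ Icc a m, γ u ≠ γ b := fun u hu h ↦ by
    have := hinj ⟨hu.1, hu.2.trans hmb.le⟩ mb h
    linarith [hu.2]
  obtain ⟨u₁, hu₁, hmin₁⟩ := isCompact_Icc.exists_isMinOn (nonempty_Icc.2 hmb.le)
    (f := fun u ↦ ‖γ a - γ u‖) (by fun_prop)
  obtain ⟨u₂, hu₂, hmin₂⟩ := isCompact_Icc.exists_isMinOn (nonempty_Icc.2 ham.le)
    (f := fun u ↦ ‖γ u - γ b‖) (by fun_prop)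
  set d := min ‖γ a - γ u₁‖ ‖γ u₂ - γ b‖ with hd
  have hd0 : 0 < d := lt_min (norm_pos_iff.2 (sub_ne_zero.2 (hm1 _ hu₁)))
    (norm_pos_iff.2 (sub_ne_zero.2 (hm2 _ hu₂)))
  have hd1 : ∀ u ∈ Icc m b, d ≤ ‖γ a - γ u‖ := fun u hu ↦ (min_le_left _ _).trans (hmin₁ hu)
  have hd2 : ∀ u ∈ Icc a m, d ≤ ‖γ u - γ b‖ := fun u hu ↦ (min_le_right _ _).trans (hmin₂ hu)
  refine ⟨d / 200, by positivity, fun g hg hclose hne hV ↦ ?_⟩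
  set cl := logVar (fun u ↦ γ a - γ u) m b + logVar (fun u ↦ γ u - γ b) a m with hcl
  have hsum : ∀ i j, i ≠ j → ‖(logVar (fun v ↦ g j v - g i m) a b - cl) +
      (logVar (fun v ↦ g i v - g j m) a b - cl)‖ ≤ 12 * (1 / 100) := by
    intro i j hij
    have := norm_logVar_add_logVar_sub_le (κ := 1 / 100) ham.le hmb.le hγ (hg i) (hg j)
      (by norm_num) (hne i j hij) hm1 hm2
      (fun u hu p hp q hq ↦ by linarith [hclose i p hp, hclose j q hq, hd1 u hu])
      (fun u hu p hp q hq ↦ by linarith [hclose i p hp, hclose j q hq, hd2 u hu])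
    convert this using 2
    rw [hcl]
    ring
  have hexp : ‖Complex.exp (logVar (fun v ↦ g 0 v - g 2 m) a b - cl) + 1‖ ≤ 4 * (1 / 100) := by
    have c1 : γ a - γ m ≠ 0 := sub_ne_zero.2 (hm1 m (left_mem_Icc.2 hmb.le))
    have c2 : γ m - γ b ≠ 0 := sub_ne_zero.2 (hm2 m (right_mem_Icc.2 ham.le))
    have c3 : γ a - γ b ≠ 0 := sub_ne_zero.2 (hm2 a (left_mem_Icc.2 ham.le))
    have e1 : Complex.exp cl = -(γ b - γ m) / (γ a - γ m) := by
      rw [hcl, Complex.exp_add, exp_logVar (f := fun u ↦ γ a - γ u) hmb.le (by fun_prop)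
        fun u hu ↦ sub_ne_zero.2 (hm1 u hu), exp_logVar (f := fun u ↦ γ u - γ b) ham.le
        (by fun_prop) fun u hu ↦ sub_ne_zero.2 (hm2 u hu)]
      field_simp
      ring
    have e2 : Complex.exp (logVar (fun v ↦ g 0 v - g 2 m) a b) =
        (g 0 b - g 2 m) / (g 0 a - g 2 m) :=
      exp_logVar (f := fun v ↦ g 0 v - g 2 m) hab.le ((hg 0).sub continuous_const).continuousOn
        fun v hv ↦ sub_ne_zero.2 (hne 0 2 (by decide) v hv m mm)
    have tri : ∀ t ∈ Icc a b, ‖g 0 t - g 2 m - (γ t - γ m)‖ ≤ d / 100 := by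
      intro t ht
      have h1 : g 0 t - g 2 m - (γ t - γ m) = (g 0 t - γ t) - (g 2 m - γ m) := by ring
      rw [h1]
      have := norm_sub_le (g 0 t - γ t) (g 2 m - γ m)
      linarith [hclose 0 t ht, hclose 2 m mm]
    rw [Complex.exp_sub, e1, e2]
    refine norm_div_add_one_le (by norm_num) (by rw [← neg_sub]; exact neg_ne_zero.2 c2) c1 ?_ ?_
    · have := hd2 m (right_mem_Icc.2 ham.le)
      rw [norm_sub_rev] at this
      linarith [tri b mb]
    · have := hd1 m (left_mem_Icc.2 hmb.le)
      linarith [tri a ma]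
  set v : Fin 3 → Fin 3 → ℂ := fun i j ↦ logVar (fun t ↦ g j t - g i m) a b - cl with hv
  have w1 : ‖v 2 0 - v 2 1‖ ≤ 1 / 20 := by
    simpa [hv] using hV 2 0 1 (by decide) (by decide) (by decide)
  have w2 : ‖v 0 1 - v 0 2‖ ≤ 1 / 20 := by
    simpa [hv] using hV 0 1 2 (by decide) (by decide) (by decide)
  have w3 : ‖v 1 2 - v 1 0‖ ≤ 1 / 20 := by
    simpa [hv] using hV 1 2 0 (by decide) (by decide) (by decide)
  have z1 : ‖v 2 1 + v 1 2‖ ≤ 12 * (1 / 100) := hsum 2 1 (by decide)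
  have z2 : ‖v 1 0 + v 0 1‖ ≤ 12 * (1 / 100) := hsum 1 0 (by decide)
  have z3 : ‖v 0 2 + v 2 0‖ ≤ 12 * (1 / 100) := hsum 0 2 (by decide)
  have hfin : 2 * v 2 0 = (v 2 0 - v 2 1) + (v 2 1 + v 1 2) - (v 1 2 - v 1 0) -
      (v 1 0 + v 0 1) + (v 0 1 - v 0 2) + (v 0 2 + v 2 0) := by ring
  have hnorm : ‖2 * v 2 0‖ ≤ 3 * (1 / 20) + 3 * (12 * (1 / 100)) := by
    rw [hfin]
    refine (norm_add_le_of_le (norm_add_le_of_le (norm_sub_le_of_le (norm_sub_le_of_le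
      (norm_add_le_of_le w1 z1) w3) z2) w2) z3).trans (by norm_num)
  rw [norm_mul, Complex.norm_ofNat] at hnorm
  have hsmall : ‖v 2 0‖ ≤ 255 / 1000 := by linarith
  have h1 := Complex.norm_exp_sub_one_le (x := v 2 0) (by linarith)
  have h2 : (2 : ℂ) = (Complex.exp (v 2 0) + 1) - (Complex.exp (v 2 0) - 1) := by ring
  have h3 := norm_sub_le (Complex.exp (v 2 0) + 1) (Complex.exp (v 2 0) - 1)
  rw [← h2, Complex.norm_ofNat] at h3
  linarith

/-! ### Arcs following a fixed arc -/

theorem logVar_comp_add_left {f : ℝ → ℂ} {t a b : ℝ} (hab : a ≤ b)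
    (hf : ContinuousOn f (Icc (t + a) (t + b))) (h0 : ∀ s ∈ Icc (t + a) (t + b), f s ≠ 0) :
    logVar (fun s ↦ f (t + s)) a b = logVar f (t + a) (t + b) := by
  have hab' : t + a ≤ t + b := by linarith
  obtain ⟨G, hG⟩ := exists_isLogOn hab' hf h0
  have hm : MapsTo (fun s ↦ t + s) (Icc a b) (Icc (t + a) (t + b)) := fun s hs ↦
    ⟨by linarith [hs.1], by linarith [hs.2]⟩
  have h1 : IsLogOn (fun s ↦ G (t + s)) (fun s ↦ f (t + s)) a b :=
    ⟨hG.1.comp (by fun_prop) hm, fun s hs ↦ hG.2 _ (hm hs)⟩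
  rw [h1.logVar_eq hab, hG.logVar_eq hab']

/-- A model arc of the curve `γ`, two discs around its end points, and a function `u` which is
increasing along the curve near the model arc and separates the discs. -/
structure Frame (γ : ℝ → ℂ) (u : ℝ → ℝ) where
  /-- initial time of the model arc -/
  A : ℝ
  /-- final time of the model arc -/
  B : ℝ
  /-- size of the neighbourhood of the model arc -/
  R : ℝ
  /-- radius of the discs -/
  r : ℝ
  /-- time spent close to the discs -/
  η : ℝ
  /-- closeness of arcs to the model arc -/
  ε : ℝ
  /-- upper bound of `u` on the first disc -/
  k₁ : ℝ
  /-- lower bound of `u` on the second disc -/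
  k₂ : ℝ
  cont : Continuous γ
  inj : InjOn γ (Ici 0)
  ucont : Continuous u
  hA : 0 < A
  hA1 : A < 1
  hB1 : 1 < B
  hB : B < 2
  ε_pos : 0 < ε
  hεr : ε ≤ r
  hrR : 1000 * r ≤ R
  farA : 2 * R ≤ ‖γ 1 - γ A‖
  farB : 2 * R ≤ ‖γ 1 - γ B‖
  farAB : R ≤ ‖γ A - γ B‖
  nearA : ∀ v ∈ Icc A B, v ≤ A + η → ‖γ v - γ A‖ ≤ R / 1000
  nearB : ∀ v ∈ Icc A B, B - η ≤ v → ‖γ v - γ B‖ ≤ R / 1000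
  offA : ∀ v ∈ Icc A B, A + η < v → 2 * r < ‖γ v - γ A‖
  offB : ∀ v ∈ Icc A B, v < B - η → 2 * r < ‖γ v - γ B‖
  hk : k₁ < k₂
  disc₁ : ∀ t, 0 ≤ t → γ t ∈ Metric.closedBall (γ A) r → u t < k₁
  disc₂ : ∀ t, 0 ≤ t → γ t ∈ Metric.closedBall (γ B) r → k₂ < u t
  incr : ∀ t, 0 ≤ t → ∀ v ∈ Icc A B, ‖γ t - γ v‖ < R →
    ∀ᶠ s in 𝓝 t, (s < t → u s < u t) ∧ (t < s → u t < u s)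
  mid : ∀ t, 0 ≤ t → ‖γ t - γ 1‖ ≤ ε → k₁ < u t ∧ u t < k₂
  recur : ∃ τ : ℕ → ℝ, Tendsto τ atTop atTop ∧ ∀ s, 0 ≤ s →
    Tendsto (fun n ↦ γ (s + τ n)) atTop (𝓝 (γ s)) ∧
      Tendsto (fun n ↦ u (s + τ n)) atTop (𝓝 (u s))

namespace Frame

variable {γ : ℝ → ℂ} {u : ℝ → ℝ} (S : Frame γ u)

theorem hAB : S.A ≤ S.B := S.hA1.le.trans S.hB1.le

theorem r_pos : 0 < S.r := S.ε_pos.trans_le S.hεr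

/-- The arc of `γ` starting at time `t` follows the model arc. -/
def Follows (t : ℝ) : Prop := 0 ≤ t ∧ ∀ v ∈ Icc S.A S.B, ‖γ (t + v) - γ v‖ ≤ S.ε

/-- A piece of an arc joining the two discs. -/
structure Trim (t : ℝ) where
  /-- initial time -/
  a : ℝ
  /-- final time -/
  b : ℝ
  ha : t + S.A ≤ a
  ha' : a ≤ t + S.A + S.η
  hb' : t + S.B - S.η ≤ b
  hb : b ≤ t + S.B
  hab : a ≤ b
  mema : γ a ∈ Metric.closedBall (γ S.A) S.r
  memb : γ b ∈ Metric.closedBall (γ S.B) S.r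
  avoid : ∀ s ∈ Ioo a b, γ s ∉ Metric.closedBall (γ S.A) S.r ∪ Metric.closedBall (γ S.B) S.r

theorem disjoint_discs :
    Disjoint (Metric.closedBall (γ S.A) S.r) (Metric.closedBall (γ S.B) S.r) := by
  refine Metric.closedBall_disjoint_closedBall ?_
  rw [dist_eq_norm]
  linarith [S.farAB, S.hrR, S.r_pos]

variable {S}

theorem Follows.exists_trim {t : ℝ} (h : S.Follows t) : Nonempty (S.Trim t) := by
  have hAB := S.hAB
  have lt := S.hA1.trans S.hB1
  obtain ⟨a, ⟨ha, haD⟩, hmax⟩ := (isCompact_Icc.inter_right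
    (Metric.isClosed_closedBall.preimage S.cont)).exists_isGreatest
    (s := Icc (t + S.A) (t + S.B) ∩ γ ⁻¹' Metric.closedBall (γ S.A) S.r)
    ⟨t + S.A, left_mem_Icc.2 (by linarith), by
      have := h.2 S.A (left_mem_Icc.2 hAB)
      rw [mem_preimage, Metric.mem_closedBall, dist_eq_norm]
      exact this.trans S.hεr⟩
  obtain ⟨b, ⟨hb, hbD⟩, hmin⟩ := (isCompact_Icc.inter_right
    (Metric.isClosed_closedBall.preimage S.cont)).exists_isLeast
    (s := Icc a (t + S.B) ∩ γ ⁻¹' Metric.closedBall (γ S.B) S.r)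
    ⟨t + S.B, right_mem_Icc.2 ha.2, by
      have := h.2 S.B (right_mem_Icc.2 hAB)
      rw [mem_preimage, Metric.mem_closedBall, dist_eq_norm]
      exact this.trans S.hεr⟩
  refine ⟨⟨a, b, ha.1, ?_, ?_, hb.2, hb.1, haD, hbD, ?_⟩⟩
  · by_contra! hlt
    have hm : a - t ∈ Icc S.A S.B := ⟨by linarith [ha.1], by linarith [ha.2]⟩
    have h1 := S.offA (a - t) hm (by linarith)
    have h2 := h.2 (a - t) hm
    rw [add_sub_cancel] at h2
    rw [mem_preimage, Metric.mem_closedBall, dist_eq_norm] at haD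
    have h3 := norm_sub_le (γ a - γ S.A) (γ a - γ (a - t))
    rw [sub_sub_sub_cancel_left] at h3
    linarith [S.hεr]
  · by_contra! hlt
    have hm : b - t ∈ Icc S.A S.B := ⟨by linarith [ha.1, hb.1], by linarith [hb.2]⟩
    have h1 := S.offB (b - t) hm (by linarith)
    have h2 := h.2 (b - t) hm
    rw [add_sub_cancel] at h2
    rw [mem_preimage, Metric.mem_closedBall, dist_eq_norm] at hbD
    have h3 := norm_sub_le (γ b - γ S.B) (γ b - γ (b - t))
    rw [sub_sub_sub_cancel_left] at h3
    linarith [S.hεr]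
  · rintro s hs (hD | hD)
    · exact absurd (hmax ⟨⟨ha.1.trans hs.1.le, hs.2.le.trans hb.2⟩, hD⟩) (not_le.2 hs.1)
    · exact absurd (hmin ⟨⟨hs.1.le, hs.2.le.trans hb.2⟩, hD⟩) (not_le.2 hs.2)

/-- Near the beginning, an arc following the model arc stays close to the first disc. -/
theorem Follows.norm_sub_A_le {t s : ℝ} (h : S.Follows t) (h1 : t + S.A ≤ s)
    (h2 : s ≤ t + S.A + S.η) (h3 : s ≤ t + S.B) : ‖γ s - γ S.A‖ ≤ S.R / 500 := by
  have hm : s - t ∈ Icc S.A S.B := ⟨by linarith, by linarith⟩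
  have e1 := S.nearA _ hm (by linarith)
  have e2 := h.2 _ hm
  rw [add_sub_cancel] at e2
  have e3 := norm_add_le (γ s - γ (s - t)) (γ (s - t) - γ S.A)
  rw [sub_add_sub_cancel] at e3
  linarith [S.hεr, S.hrR]

theorem Follows.norm_sub_B_le {t s : ℝ} (h : S.Follows t) (h1 : t + S.A ≤ s)
    (h2 : t + S.B - S.η ≤ s) (h3 : s ≤ t + S.B) : ‖γ s - γ S.B‖ ≤ S.R / 500 := by
  have hm : s - t ∈ Icc S.A S.B := ⟨by linarith, by linarith⟩
  have e1 := S.nearB _ hm (by linarith)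
  have e2 := h.2 _ hm
  rw [add_sub_cancel] at e2
  have e3 := norm_add_le (γ s - γ (s - t)) (γ (s - t) - γ S.B)
  rw [sub_add_sub_cancel] at e3
  linarith [S.hεr, S.hrR]

/-- Trimming an arc hardly changes its logarithmic variation. -/
theorem Follows.norm_logVar_sub_trim_le {t : ℝ} (h : S.Follows t) (T : S.Trim t) {x : ℂ}
    (hx : x ∉ γ '' Icc (t + S.A) (t + S.B)) (hA : S.R ≤ ‖γ S.A - x‖) (hB : S.R ≤ ‖γ S.B - x‖) :
    ‖logVar (fun s ↦ γ s - x) T.a T.b - logVar (fun v ↦ γ (t + v) - x) S.A S.B‖ ≤ 6 / 500 := by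
  have hR : 0 < S.R := by linarith [S.hrR, S.r_pos]
  have hne : ∀ s ∈ Icc (t + S.A) (t + S.B), γ s - x ≠ 0 := fun s hs h ↦
    hx (sub_eq_zero.1 h ▸ mem_image_of_mem γ hs)
  have hc : Continuous fun s ↦ γ s - x := S.cont.sub continuous_const
  have e0 := logVar_comp_add_left (f := fun s ↦ γ s - x) S.hAB hc.continuousOn hne
  have e1 := logVar_add (T.ha.trans T.hab) T.hb hc.continuousOn hne
  have e2 := logVar_add T.ha T.hab hc.continuousOn fun s hs ↦ hne s ⟨hs.1, hs.2.trans T.hb⟩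
  have f1 := norm_logVar_sub_const_le (κ := 1 / 500) (p := γ S.A) (x := x) T.ha S.cont.continuousOn
    (fun h' ↦ by rw [h', sub_self, norm_zero] at hA; linarith) (by norm_num) fun s hs ↦ by
      have := h.norm_sub_A_le hs.1 (hs.2.trans T.ha') (hs.2.trans (T.hab.trans T.hb))
      linarith
  have f2 := norm_logVar_sub_const_le (κ := 1 / 500) (p := γ S.B) (x := x) T.hb S.cont.continuousOn
    (fun h' ↦ by rw [h', sub_self, norm_zero] at hB; linarith) (by norm_num) fun s hs ↦ by
      have := h.norm_sub_B_le ((T.ha.trans T.hab).trans hs.1) (T.hb'.trans hs.1) hs.2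
      linarith
  rw [e0, ← e1, ← e2]
  have := norm_add_le (logVar (fun s ↦ γ s - x) (t + S.A) T.a)
    (logVar (fun s ↦ γ s - x) T.b (t + S.B))
  rw [← norm_neg] at this
  refine (le_of_eq ?_).trans (this.trans (b := _) (by linarith))
  congr 1
  ring

/-- The loop made of two trimmed arcs. -/
def Trim.twoArcs {p q : ℝ} (P : S.Trim p) (Q : S.Trim q) (hp : 0 ≤ p) (hpq : p + 3 ≤ q) :
    TwoArcs γ where
  c₁ := γ S.A
  c₂ := γ S.B
  r := S.r
  a := P.a
  b := P.b
  a' := Q.a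
  b' := Q.b
  cont := S.cont
  inj := S.inj
  r_pos := S.r_pos
  a_nonneg := by linarith [P.ha, S.hA]
  hab := P.hab
  hba' := by linarith [P.hb, Q.ha, S.hA, S.hB]
  hab' := Q.hab
  disj := S.disjoint_discs
  ha := P.mema
  hb := P.memb
  ha' := Q.mema
  hb' := Q.memb
  avoid := P.avoid
  avoid' := Q.avoid

theorem norm_index_sub_le {p q : ℝ} (hp : S.Follows p) (hq : S.Follows q) (hpq : p + 3 ≤ q)
    (P : S.Trim p) (Q : S.Trim q) {x : ℂ} (hxp : x ∉ γ '' Icc (p + S.A) (p + S.B))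
    (hxq : x ∉ γ '' Icc (q + S.A) (q + S.B)) (hA : S.R ≤ ‖γ S.A - x‖) (hB : S.R ≤ ‖γ S.B - x‖) :
    ‖(P.twoArcs Q hp.1 hpq).index x - (logVar (fun v ↦ γ (p + v) - x) S.A S.B -
      logVar (fun v ↦ γ (q + v) - x) S.A S.B)‖ ≤ 1 / 20 := by
  have hR : 0 < S.R := by linarith [S.hrR, S.r_pos]
  have e1 := hp.norm_logVar_sub_trim_le P hxp hA hB
  have e2 := hq.norm_logVar_sub_trim_le Q hxq hA hB
  have lA : ∀ z ∈ Metric.closedBall (γ S.A) S.r,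
      ‖Complex.log ((z - x) / (γ S.A - x))‖ ≤ 3 / 2 * (1 / 1000) := fun z hz ↦
    norm_log_div_le (fun h' ↦ by rw [h', sub_self, norm_zero] at hA; linarith) (by norm_num) (by
      rw [Metric.mem_closedBall, dist_eq_norm] at hz
      linarith [S.hrR])
  have lB : ∀ z ∈ Metric.closedBall (γ S.B) S.r,
      ‖Complex.log ((z - x) / (γ S.B - x))‖ ≤ 3 / 2 * (1 / 1000) := fun z hz ↦
    norm_log_div_le (fun h' ↦ by rw [h', sub_self, norm_zero] at hB; linarith) (by norm_num) (by
      rw [Metric.mem_closedBall, dist_eq_norm] at hz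
      linarith [S.hrR])
  have key := norm_add_le_of_le (norm_sub_le_of_le e1 e2) (norm_sub_le_of_le
    (norm_sub_le_of_le (lA _ P.mema) (lA _ Q.mema)) (norm_sub_le_of_le (lB _ P.memb) (lB _ Q.memb)))
  refine (le_of_eq ?_).trans (key.trans (by norm_num))
  congr 1
  simp only [TwoArcs.index, Trim.twoArcs]
  ring

/-- The index about a point of the curve far from the model arc vanishes. -/
theorem exists_norm_lt_of_index_ne_zero {p q : ℝ} (hp : S.Follows p) (hq : S.Follows q)
    (hpq : p + 3 ≤ q) (P : S.Trim p) (Q : S.Trim q) {x : ℂ}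
    (hx : x ∉ (P.twoArcs Q hp.1 hpq).X) (h : (P.twoArcs Q hp.1 hpq).index x ≠ 0) :
    ∃ v ∈ Icc S.A S.B, ‖x - γ v‖ < S.R := by
  by_contra! hfar
  have hR : 0 < S.R := by linarith [S.hrR, S.r_pos]
  refine h (eq_of_exp_eq_one_of_norm_sub_lt (TwoArcs.exp_index _ hx) Complex.exp_zero ?_)
  have hoff : ∀ t, S.Follows t → x ∉ γ '' Icc (t + S.A) (t + S.B) := by
    rintro t ht ⟨s, hs, rfl⟩
    have hm : s - t ∈ Icc S.A S.B := ⟨by linarith [hs.1], by linarith [hs.2]⟩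
    have e1 := hfar _ hm
    have e2 := ht.2 _ hm
    rw [add_sub_cancel] at e2
    linarith [S.hεr, S.hrR]
  have hV : ∀ t, S.Follows t → ‖logVar (fun v ↦ γ (t + v) - x) S.A S.B -
      logVar (fun v ↦ γ v - x) S.A S.B‖ ≤ 3 * (1 / 1000) := by
    intro t ht
    have hc := S.cont
    refine norm_logVar_sub_le S.hAB (by fun_prop) (by fun_prop) (fun v hv h' ↦ ?_) (by norm_num)
      fun v hv ↦ ?_
    · have := hfar v hv
      rw [← norm_neg, neg_sub, h', norm_zero] at this
      linarith
    · have e1 := hfar v hv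
      have e2 := ht.2 v hv
      rw [norm_sub_rev] at e1
      rw [sub_sub_sub_cancel_right]
      linarith [S.hεr, S.hrR]
  have e0 := norm_index_sub_le hp hq hpq P Q (hoff p hp) (hoff q hq)
    (by rw [norm_sub_rev]; exact hfar _ (left_mem_Icc.2 S.hAB))
    (by rw [norm_sub_rev]; exact hfar _ (right_mem_Icc.2 S.hAB))
  have key := norm_add_le_of_le e0 (norm_sub_le_of_le (hV p hp) (hV q hq))
  rw [sub_zero]
  refine (le_of_eq ?_).trans_lt (key.trans_lt (by norm_num))
  congr 1
  ring

/-- The logarithmic variations of two arcs following the model arc, about the middle point of a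
third one, almost agree. -/
theorem norm_logVar_sub_logVar_le {p q k : ℝ} (hp : S.Follows p) (hq : S.Follows q)
    (hk : S.Follows k) (hpq : p + 3 ≤ q) (hkp : 3 ≤ |k - p|) (hkq : 3 ≤ |k - q|) :
    ‖logVar (fun v ↦ γ (p + v) - γ (k + 1)) S.A S.B -
      logVar (fun v ↦ γ (q + v) - γ (k + 1)) S.A S.B‖ ≤ 1 / 20 := by
  obtain ⟨P⟩ := hp.exists_trim
  obtain ⟨Q⟩ := hq.exists_trim
  have hR : 0 < S.R := by linarith [S.hrR, S.r_pos]
  have hk0 := hk.1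
  have h1 := hk.2 1 ⟨S.hA1.le, S.hB1.le⟩
  have hA := S.hA
  have hB := S.hB
  have hoff : ∀ t, S.Follows t → 3 ≤ |k - t| → γ (k + 1) ∉ γ '' Icc (t + S.A) (t + S.B) := by
    rintro t ht hkt ⟨s, hs, hst⟩
    have ht0 := ht.1
    have := S.inj (show 0 ≤ s by linarith [hs.1]) (show 0 ≤ k + 1 by linarith) hst
    rcases le_abs.1 hkt with h' | h' <;> linarith [hs.1, hs.2]
  have farA : S.R ≤ ‖γ S.A - γ (k + 1)‖ := by
    have e := norm_sub_le (γ (k + 1) - γ 1) (γ (k + 1) - γ S.A)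
    rw [sub_sub_sub_cancel_left, norm_sub_rev (γ S.A), norm_sub_rev (γ (k + 1)) (γ S.A)] at e
    linarith [S.farA, S.hεr, S.hrR]
  have farB : S.R ≤ ‖γ S.B - γ (k + 1)‖ := by
    have e := norm_sub_le (γ (k + 1) - γ 1) (γ (k + 1) - γ S.B)
    rw [sub_sub_sub_cancel_left, norm_sub_rev (γ S.B), norm_sub_rev (γ (k + 1)) (γ S.B)] at e
    linarith [S.farB, S.hεr, S.hrR]
  have e0 := norm_index_sub_le hp hq hpq P Q (hoff p hp hkp) (hoff q hq hkq) farA farB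
  set T := P.twoArcs Q hp.1 hpq with hT
  have hX : γ (k + 1) ∉ T.X := by
    refine T.notMem_X.2 ⟨fun h' ↦ ?_, fun h' ↦ ?_,
      fun h' ↦ hoff p hp hkp (image_mono (Icc_subset_Icc P.ha P.hb) h'),
      fun h' ↦ hoff q hq hkq (image_mono (Icc_subset_Icc Q.ha Q.hb) h')⟩
    · change γ (k + 1) ∈ Metric.closedBall (γ S.A) S.r at h'
      rw [Metric.mem_closedBall, dist_eq_norm, norm_sub_rev] at h'
      linarith [S.hrR]
    · change γ (k + 1) ∈ Metric.closedBall (γ S.B) S.r at h'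
      rw [Metric.mem_closedBall, dist_eq_norm, norm_sub_rev] at h'
      linarith [S.hrR]
  suffices h0 : T.index (γ (k + 1)) = 0 by
    rw [h0, zero_sub, norm_neg] at e0
    exact e0
  obtain ⟨τ, hτ, hrec⟩ := S.recur
  obtain ⟨g1, g2⟩ := hrec (k + 1) (by linarith)
  obtain ⟨m1, m2⟩ := S.mid (k + 1) (by linarith) h1
  obtain ⟨n, hn1, hn2, hn3, hn4⟩ := ((hτ.eventually_gt_atTop T.b').and
    ((g1.eventually (T.eventually_index_eq hX)).and
    ((g2.eventually_const_lt m1).and (g2.eventually_lt_const m2)))).exists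
  have hb0 : 0 ≤ T.b' := T.a_nonneg.trans (T.hab.trans (T.hba'.le.trans T.hab'))
  obtain ⟨g3, g4⟩ := hrec (k + 1 + τ n) (by linarith)
  rw [← hn2]
  refine T.index_eq_zero_of_recurrent S.ucont S.hk S.disc₁ S.disc₂ (fun t ht htX hti ↦ ?_)
    (by linarith) hn3 hn4 (tendsto_atTop_add_const_left _ _ hτ) g3 g4
  obtain ⟨v, hv, hvR⟩ := exists_norm_lt_of_index_ne_zero hp hq hpq P Q htX hti
  exact S.incr t (by linarith) v hv hvR

end Frame

/-! ### Injective recurrent curves -/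

/-- An injective recurrent curve in the plane, such that the near future of a point depends
continuously on the point. -/
structure RecurrentCurve (γ : ℝ → ℂ) : Prop where
  cont : Continuous γ
  inj : InjOn γ (Ici 0)
  shadow : ∀ s, 0 ≤ s → ∀ R ε : ℝ, 0 < ε → ∃ δ > 0, ∀ t, 0 ≤ t → ‖γ t - γ s‖ < δ →
    ∀ r ∈ Icc 0 R, ‖γ (t + r) - γ (s + r)‖ < ε
  recur : ∃ τ : ℕ → ℝ, Tendsto τ atTop atTop ∧ Tendsto (fun n ↦ γ (τ n)) atTop (𝓝 (γ 0))

/-- The mean distance to `γ 1` during one unit of time. -/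
noncomputable def meanDist (γ : ℝ → ℂ) (t : ℝ) : ℝ := ∫ s in t..t + 1, ‖γ s - γ 1‖

theorem hasDerivAt_meanDist {γ : ℝ → ℂ} (hγ : Continuous γ) (t : ℝ) :
    HasDerivAt (meanDist γ) (‖γ (t + 1) - γ 1‖ - ‖γ t - γ 1‖) t := by
  have hc : Continuous fun s ↦ ‖γ s - γ 1‖ := by fun_prop
  have h1 : ∀ t, HasDerivAt (fun t ↦ ∫ s in (0 : ℝ)..t, ‖γ s - γ 1‖) ‖γ t - γ 1‖ t := fun t ↦
    intervalIntegral.integral_hasDerivAt_right (hc.intervalIntegrable _ _)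
      hc.stronglyMeasurable.stronglyMeasurableAtFilter hc.continuousAt
  have h2 : meanDist γ = fun t ↦ (∫ s in (0 : ℝ)..t + 1, ‖γ s - γ 1‖) -
      ∫ s in (0 : ℝ)..t, ‖γ s - γ 1‖ := by
    funext t
    rw [meanDist, intervalIntegral.integral_interval_sub_left (hc.intervalIntegrable _ _)
      (hc.intervalIntegrable _ _)]
  rw [h2]
  exact ((h1 (t + 1)).comp_add_const t 1).sub (h1 t)

theorem eventually_lt_and_lt_of_hasDerivAt {u : ℝ → ℝ} {t u' : ℝ} (h : HasDerivAt u u' t)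
    (hpos : 0 < u') : ∀ᶠ s in 𝓝 t, (s < t → u s < u t) ∧ (t < s → u t < u s) := by
  have h1 := (hasDerivAt_iff_tendsto_slope.1 h).eventually_const_lt hpos
  rw [eventually_nhdsWithin_iff] at h1
  filter_upwards [h1] with s hs
  refine ⟨fun hst ↦ ?_, fun hst ↦ ?_⟩
  · have := hs hst.ne
    rw [slope_def_field, ← neg_div_neg_eq] at this
    have := (div_pos_iff_of_pos_right (by linarith)).1 this
    linarith
  · have := hs hst.ne'
    rw [slope_def_field] at this
    have := (div_pos_iff_of_pos_right (by linarith)).1 this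
    linarith

theorem exists_pos_le_norm_sub {γ : ℝ → ℂ} (hγ : Continuous γ) {K : Set ℝ} (hK : IsCompact K)
    {c : ℂ} (hc : ∀ v ∈ K, γ v ≠ c) : ∃ d > 0, ∀ v ∈ K, d ≤ ‖γ v - c‖ := by
  obtain ⟨d, hd, hball⟩ := Metric.isOpen_iff.1 (hK.image hγ).isClosed.isOpen_compl c
    (by rintro ⟨v, hv, h⟩; exact hc v hv h)
  refine ⟨d, hd, fun v hv ↦ ?_⟩
  by_contra! h
  exact hball (by simpa [dist_eq_norm] using h) (mem_image_of_mem γ hv)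

namespace RecurrentCurve

variable {γ : ℝ → ℂ}

theorem tendsto_of_tendsto (h : RecurrentCurve γ) {s : ℝ} (hs : 0 ≤ s) {τ : ℕ → ℝ}
    (hτ : Tendsto τ atTop atTop)
    (h0 : Tendsto (fun n ↦ γ (τ n)) atTop (𝓝 (γ 0))) :
    Tendsto (fun n ↦ γ (s + τ n)) atTop (𝓝 (γ s)) := by
  rw [Metric.tendsto_nhds]
  intro ε hε
  obtain ⟨δ, hδ, H⟩ := h.shadow 0 le_rfl s ε hε
  filter_upwards [Metric.tendsto_nhds.1 h0 δ hδ, hτ.eventually_ge_atTop 0] with n hn hn0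
  rw [dist_eq_norm] at hn ⊢
  have := H (τ n) hn0 hn s ⟨hs, le_rfl⟩
  rwa [zero_add, add_comm] at this

theorem exists_meanDist_close (h : RecurrentCurve γ) {s : ℝ} (hs : 0 ≤ s) {ε : ℝ} (hε : 0 < ε) :
    ∃ δ > 0, ∀ t, 0 ≤ t → ‖γ t - γ s‖ < δ → |meanDist γ t - meanDist γ s| < ε := by
  obtain ⟨δ, hδ, H⟩ := h.shadow s hs 1 (ε / 2) (by positivity)
  refine ⟨δ, hδ, fun t ht hts ↦ ?_⟩
  have hc := h.cont
  have key : ∀ t, meanDist γ t = ∫ r in (0 : ℝ)..1, ‖γ (t + r) - γ 1‖ := fun t ↦ by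
    rw [meanDist, intervalIntegral.integral_comp_add_left (fun r ↦ ‖γ r - γ 1‖), add_zero]
  rw [key, key, ← intervalIntegral.integral_sub
    (Continuous.intervalIntegrable (by fun_prop) _ _)
    (Continuous.intervalIntegrable (by fun_prop) _ _)]
  have := intervalIntegral.norm_integral_le_of_norm_le_const (a := 0) (b := 1) (C := ε / 2)
    (f := fun r ↦ ‖γ (t + r) - γ 1‖ - ‖γ (s + r) - γ 1‖) fun r hr ↦ by
      rw [uIoc_of_le zero_le_one] at hr
      refine (abs_norm_sub_norm_le _ _).trans ?_
      rw [sub_sub_sub_cancel_right]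
      exact (H t ht hts r ⟨hr.1.le, hr.2⟩).le
  rw [sub_zero, abs_one, mul_one, Real.norm_eq_abs] at this
  linarith

theorem tendsto_meanDist (h : RecurrentCurve γ) {s : ℝ} (hs : 0 ≤ s) {τ : ℕ → ℝ}
    (hτ : Tendsto τ atTop atTop)
    (h0 : Tendsto (fun n ↦ γ (τ n)) atTop (𝓝 (γ 0))) :
    Tendsto (fun n ↦ meanDist γ (s + τ n)) atTop (𝓝 (meanDist γ s)) := by
  rw [Metric.tendsto_nhds]
  intro ε hε
  obtain ⟨δ, hδ, H⟩ := h.exists_meanDist_close hs hε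
  filter_upwards [Metric.tendsto_nhds.1 (h.tendsto_of_tendsto hs hτ h0) δ hδ,
    hτ.eventually_ge_atTop 0] with n hn hn0
  rw [dist_eq_norm] at hn
  exact H _ (by linarith) hn

/-- Near an arc along which the derivative of the mean distance is positive, it is positive. -/
theorem exists_deriv_pos (h : RecurrentCurve γ) {A B : ℝ} (hA : 0 ≤ A)
    (hq : ∀ v ∈ Icc A B, 0 < ‖γ (v + 1) - γ 1‖ - ‖γ v - γ 1‖) :
    ∃ R > 0, ∀ t, 0 ≤ t → ∀ v ∈ Icc A B, ‖γ t - γ v‖ < R →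
      0 < ‖γ (t + 1) - γ 1‖ - ‖γ t - γ 1‖ := by
  have hex : ∀ v ∈ Icc A B, ∃ δ > 0, ∀ t, 0 ≤ t → ‖γ t - γ v‖ < δ →
      0 < ‖γ (t + 1) - γ 1‖ - ‖γ t - γ 1‖ := by
    intro v hv
    obtain ⟨δ, hδ, H⟩ := h.shadow v (hA.trans hv.1) 1 _ (half_pos (hq v hv))
    refine ⟨δ, hδ, fun t ht htv ↦ ?_⟩
    have e1 := H t ht htv 0 ⟨le_rfl, zero_le_one⟩
    have e2 := H t ht htv 1 ⟨zero_le_one, le_rfl⟩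
    rw [add_zero, add_zero] at e1
    have e3 := norm_add_le (γ t - γ v) (γ v - γ 1)
    have e4 := norm_sub_le (γ (t + 1) - γ 1) (γ (t + 1) - γ (v + 1))
    rw [sub_add_sub_cancel] at e3
    rw [sub_sub_sub_cancel_left] at e4
    linarith
  choose! δ hδ H using hex
  obtain ⟨R, hR, hsub⟩ := ((isCompact_Icc (a := A) (b := B)).image
    h.cont).exists_thickening_subset_open
    (t := ⋃ v ∈ Icc A B, Metric.ball (γ v) (δ v))
    (isOpen_biUnion fun v _ ↦ Metric.isOpen_ball) (by
      rintro _ ⟨v, hv, rfl⟩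
      exact mem_biUnion hv (Metric.mem_ball_self (hδ v hv)))
  refine ⟨R, hR, fun t ht v hv htv ↦ ?_⟩
  have hm : γ t ∈ Metric.thickening R (γ '' Icc A B) :=
    Metric.mem_thickening_iff.2 ⟨γ v, mem_image_of_mem γ hv, by rwa [dist_eq_norm]⟩
  obtain ⟨w, hw, hw'⟩ := mem_iUnion₂.1 (hsub hm)
  rw [Metric.mem_ball, dist_eq_norm] at hw'
  exact H w hw t ht hw'

theorem exists_window (h : RecurrentCurve γ) : ∃ A B : ℝ, 0 < A ∧ A < 1 ∧ 1 < B ∧ B < 2 ∧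
    ∀ v ∈ Icc A B, 0 < ‖γ (v + 1) - γ 1‖ - ‖γ v - γ 1‖ := by
  have hc := h.cont
  have hq : Continuous fun v ↦ ‖γ (v + 1) - γ 1‖ - ‖γ v - γ 1‖ := by fun_prop
  have h2 : γ (1 + 1) ≠ γ 1 := fun h' ↦ by
    have := h.inj (show (0 : ℝ) ≤ 1 + 1 by norm_num) (show (0 : ℝ) ≤ 1 by norm_num) h'
    norm_num at this
  have h1 : 0 < ‖γ (1 + 1) - γ 1‖ - ‖γ 1 - γ 1‖ := by
    rw [sub_self (γ 1), norm_zero, sub_zero]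
    exact norm_pos_iff.2 (sub_ne_zero.2 h2)
  obtain ⟨ε, hε, hball⟩ := Metric.eventually_nhds_iff.1
    (hq.continuousAt.eventually_const_lt h1)
  have m1 := min_le_left (ε / 2) (1 / 2)
  have m2 := min_le_right (ε / 2) (1 / 2)
  have m3 : 0 < min (ε / 2) (1 / 2) := by positivity
  refine ⟨1 - min (ε / 2) (1 / 2), 1 + min (ε / 2) (1 / 2), by linarith, by linarith, by linarith,
    by linarith, fun v hv ↦ hball ?_⟩
  rw [Real.dist_eq, abs_lt]
  constructor <;> linarith [hv.1, hv.2]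

theorem exists_frame (h : RecurrentCurve γ) {A B ε₀ : ℝ} (hA : 0 < A) (hA1 : A < 1)
    (hB1 : 1 < B) (hB : B < 2)
    (hq : ∀ v ∈ Icc A B, 0 < ‖γ (v + 1) - γ 1‖ - ‖γ v - γ 1‖) (hε₀ : 0 < ε₀) :
    ∃ S : Frame γ (meanDist γ), S.A = A ∧ S.B = B ∧ S.ε ≤ ε₀ := by
  have hc := h.cont
  have hAB : A < B := hA1.trans hB1
  have hd : ∀ t, HasDerivAt (meanDist γ) (‖γ (t + 1) - γ 1‖ - ‖γ t - γ 1‖) t :=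
    hasDerivAt_meanDist hc
  have hu : Continuous (meanDist γ) := continuous_iff_continuousAt.2 fun t ↦ (hd t).continuousAt
  have hmono : StrictMonoOn (meanDist γ) (Icc A B) := by
    refine strictMonoOn_of_deriv_pos (convex_Icc A B) hu.continuousOn fun v hv ↦ ?_
    rw [(hd v).deriv]
    exact hq v (interior_subset hv)
  have u1 := hmono (left_mem_Icc.2 hAB.le) ⟨hA1.le, hB1.le⟩ hA1
  have u2 := hmono ⟨hA1.le, hB1.le⟩ (right_mem_Icc.2 hAB.le) hB1
  have ne : ∀ s t, 0 ≤ s → 0 ≤ t → s ≠ t → γ s ≠ γ t := fun s t hs ht hst h' ↦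
    hst (h.inj hs ht h')
  have pos : ∀ s t, 0 ≤ s → 0 ≤ t → s ≠ t → 0 < ‖γ s - γ t‖ := fun s t hs ht hst ↦
    norm_pos_iff.2 (sub_ne_zero.2 (ne s t hs ht hst))
  obtain ⟨R', hR', hpos⟩ := h.exists_deriv_pos hA.le hq
  obtain ⟨R, hR, r1, r2, r3, r4⟩ : ∃ R > 0, R ≤ R' ∧ 2 * R ≤ ‖γ 1 - γ A‖ ∧
      2 * R ≤ ‖γ 1 - γ B‖ ∧ R ≤ ‖γ A - γ B‖ := by
    have p1 := pos 1 A zero_le_one hA.le hA1.ne'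
    have p2 := pos 1 B zero_le_one (by linarith) hB1.ne
    have p3 := pos A B hA.le (by linarith) hAB.ne
    refine ⟨min (min R' (‖γ 1 - γ A‖ / 2)) (min (‖γ 1 - γ B‖ / 2) ‖γ A - γ B‖), by positivity,
      (min_le_left _ _).trans (min_le_left _ _), ?_, ?_,
      (min_le_right _ _).trans (min_le_right _ _)⟩
    · linarith [(min_le_left (min R' (‖γ 1 - γ A‖ / 2))
        (min (‖γ 1 - γ B‖ / 2) ‖γ A - γ B‖)).trans (min_le_right _ _)]
    · linarith [(min_le_right (min R' (‖γ 1 - γ A‖ / 2))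
        (min (‖γ 1 - γ B‖ / 2) ‖γ A - γ B‖)).trans (min_le_left _ _)]
  have hcont : ∀ s, ∃ η > 0, ∀ v, |v - s| < η → ‖γ v - γ s‖ < R / 1000 := fun s ↦ by
    obtain ⟨η, hη, hball⟩ := Metric.continuousAt_iff.1 (hc.continuousAt (x := s)) (R / 1000)
      (by positivity)
    exact ⟨η, hη, fun v hv ↦ by
      have := hball (x := v) (by rwa [Real.dist_eq])
      rwa [dist_eq_norm] at this⟩
  obtain ⟨η, hη, nA, nB⟩ : ∃ η > 0, (∀ v, |v - A| ≤ η → ‖γ v - γ A‖ ≤ R / 1000) ∧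
      ∀ v, |v - B| ≤ η → ‖γ v - γ B‖ ≤ R / 1000 := by
    obtain ⟨η₁, h1, h1'⟩ := hcont A
    obtain ⟨η₂, h2, h2'⟩ := hcont B
    have m1 := min_le_left η₁ η₂
    have m2 := min_le_right η₁ η₂
    have m3 : 0 < min η₁ η₂ := lt_min h1 h2
    exact ⟨min η₁ η₂ / 2, by positivity, fun v hv ↦ (h1' v (by linarith)).le,
      fun v hv ↦ (h2' v (by linarith)).le⟩
  obtain ⟨d₁, hd₁, offA⟩ := exists_pos_le_norm_sub hc (isCompact_Icc (a := A + η) (b := B))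
    (c := γ A) fun v hv ↦ ne v A (by linarith [hv.1]) hA.le (by linarith [hv.1])
  obtain ⟨d₂, hd₂, offB⟩ := exists_pos_le_norm_sub hc (isCompact_Icc (a := A) (b := B - η))
    (c := γ B) fun v hv ↦ ne v B (by linarith [hv.1]) (by linarith) (by linarith [hv.2])
  obtain ⟨d₃, hd₃, uA⟩ := h.exists_meanDist_close hA.le
    (half_pos (sub_pos.2 u1))
  obtain ⟨d₄, hd₄, uB⟩ := h.exists_meanDist_close (s := B) (by linarith)
    (half_pos (sub_pos.2 u2))
  obtain ⟨d₅, hd₅, um⟩ := h.exists_meanDist_close (s := 1) zero_le_one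
    (lt_min (half_pos (sub_pos.2 u1)) (half_pos (sub_pos.2 u2)))
  obtain ⟨r, hr, l0, l1, l2, l3, l4⟩ : ∃ r > 0, 1000 * r ≤ R ∧ 3 * r ≤ d₁ ∧ 3 * r ≤ d₂ ∧
      2 * r ≤ d₃ ∧ 2 * r ≤ d₄ := by
    set m := min R (min (min d₁ d₂) (min d₃ d₄)) with hm
    have hm0 : 0 < m := by positivity
    have c1 : m ≤ R := min_le_left _ _
    have c2 : m ≤ d₁ := (min_le_right _ _).trans ((min_le_left _ _).trans (min_le_left _ _))
    have c3 : m ≤ d₂ := (min_le_right _ _).trans ((min_le_left _ _).trans (min_le_right _ _))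
    have c4 : m ≤ d₃ := (min_le_right _ _).trans ((min_le_right _ _).trans (min_le_left _ _))
    have c5 : m ≤ d₄ := (min_le_right _ _).trans ((min_le_right _ _).trans (min_le_right _ _))
    refine ⟨m / 1000, by positivity, ?_, ?_, ?_, ?_, ?_⟩ <;> linarith
  have m1 := min_le_left (min r ε₀) (d₅ / 2)
  obtain ⟨τ, hτ, hτ0⟩ := h.recur
  refine ⟨{
    A := A, B := B, R := R, r := r, η := η, ε := min (min r ε₀) (d₅ / 2)
    k₁ := (meanDist γ A + meanDist γ 1) / 2, k₂ := (meanDist γ 1 + meanDist γ B) / 2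
    cont := hc
    inj := h.inj
    ucont := hu
    hA := hA
    hA1 := hA1
    hB1 := hB1
    hB := hB
    ε_pos := by positivity
    hεr := m1.trans (min_le_left _ _)
    hrR := l0
    farA := r2
    farB := r3
    farAB := r4
    nearA := fun v hv hv' ↦ nA v (by rw [abs_of_nonneg] <;> linarith [hv.1])
    nearB := fun v hv hv' ↦ nB v (by rw [abs_of_nonpos] <;> linarith [hv.2])
    offA := fun v hv hv' ↦ by linarith [offA v ⟨hv'.le, hv.2⟩]
    offB := fun v hv hv' ↦ by linarith [offB v ⟨hv.1, hv'.le⟩]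
    hk := by linarith
    disc₁ := fun t ht htD ↦ by
      rw [Metric.mem_closedBall, dist_eq_norm] at htD
      have := (abs_lt.1 (uA t ht (by linarith))).2
      linarith
    disc₂ := fun t ht htD ↦ by
      rw [Metric.mem_closedBall, dist_eq_norm] at htD
      have := (abs_lt.1 (uB t ht (by linarith))).1
      linarith
    incr := fun t ht v hv htv ↦
      eventually_lt_and_lt_of_hasDerivAt (hd t) (hpos t ht v hv (htv.trans_le r1))
    mid := fun t ht ht1 ↦ by
      have := um t ht (by linarith [ht1.trans (min_le_right (min r ε₀) (d₅ / 2))])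
      have k1 := abs_lt.1 (this.trans_le (min_le_left _ _))
      have k2 := abs_lt.1 (this.trans_le (min_le_right _ _))
      constructor <;> linarith [k1.1, k2.2]
    recur := ⟨τ, hτ, fun s hs ↦ ⟨h.tendsto_of_tendsto hs hτ hτ0, h.tendsto_meanDist hs hτ hτ0⟩⟩ },
    rfl, rfl, m1.trans (min_le_right _ _)⟩

theorem false (h : RecurrentCurve γ) : False := by
  obtain ⟨A, B, hA, hA1, hB1, hB, hq⟩ := h.exists_window
  obtain ⟨ε₀, hε₀, htriple⟩ := exists_triple_bound hA1 hB1 h.cont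
    (h.inj.mono fun t ht ↦ hA.le.trans ht.1)
  obtain ⟨S, rfl, rfl, hSε⟩ := h.exists_frame hA hA1 hB1 hB hq hε₀
  obtain ⟨δ, hδ, H⟩ := h.shadow 0 le_rfl 2 S.ε S.ε_pos
  obtain ⟨τ, hτ, hτ0⟩ := h.recur
  have hfol : ∀ c : ℝ, ∃ t, c ≤ t ∧ S.Follows t := by
    intro c
    obtain ⟨n, hn, hn0, hnc⟩ := ((Metric.tendsto_nhds.1 hτ0 δ hδ).and
      ((hτ.eventually_ge_atTop 0).and (hτ.eventually_ge_atTop c))).exists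
    refine ⟨τ n, hnc, hn0, fun v hv ↦ ?_⟩
    rw [dist_eq_norm] at hn
    have := H (τ n) hn0 hn v ⟨by linarith [hv.1], by linarith [hv.2]⟩
    rw [zero_add] at this
    exact this.le
  obtain ⟨t₁, -, f₁⟩ := hfol 0
  obtain ⟨t₂, h₂, f₂⟩ := hfol (t₁ + 3)
  obtain ⟨t₃, h₃, f₃⟩ := hfol (t₂ + 3)
  set t : Fin 3 → ℝ := ![t₁, t₂, t₃] with ht
  have ft : ∀ i, S.Follows (t i) := by
    intro i
    fin_cases i
    exacts [f₁, f₂, f₃]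
  have hmono : ∀ i j, i < j → t i + 3 ≤ t j := by
    intro i j hij
    fin_cases i <;> fin_cases j <;> simp [ht] at hij ⊢ <;> linarith
  have hgap : ∀ i j, i ≠ j → 3 ≤ |t i - t j| := by
    intro i j hij
    rcases lt_or_gt_of_ne hij with h' | h'
    · exact le_abs.2 (Or.inr (by linarith [hmono i j h']))
    · exact le_abs.2 (Or.inl (by linarith [hmono j i h']))
  have hc := h.cont
  refine htriple (fun i v ↦ γ (t i + v)) (fun i ↦ by fun_prop)
    (fun i v hv ↦ ((ft i).2 v hv).trans hSε) (fun i j hij u hu v hv huv ↦ ?_)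
    fun i j k hij hjk hik ↦ ?_
  · have h0 := (ft i).1
    have h0' := (ft j).1
    have := h.inj (show 0 ≤ t i + u by linarith [hu.1]) (show 0 ≤ t j + v by linarith [hv.1]) huv
    rcases le_abs.1 (hgap i j hij) with h' | h' <;> linarith [hu.1, hu.2, hv.1, hv.2]
  · rcases lt_or_gt_of_ne hjk with h' | h'
    · exact Frame.norm_logVar_sub_logVar_le (ft j) (ft k) (ft i) (hmono j k h') (hgap i j hij)
        (hgap i k hik)
    · rw [norm_sub_rev]
      exact Frame.norm_logVar_sub_logVar_le (ft k) (ft j) (ft i) (hmono k j h') (hgap i k hik)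
        (hgap i j hij)

end RecurrentCurve

section Semiflow

variable {X : Type*} [TopologicalSpace X] {Φ : X × ℝ≥0 → X} {z : X}

/-- A recurrent orbit that is not periodic is injectively parametrised by time. -/
theorem injective_orbit_of_recurrent [T2Space X] (hΦ : Continuous Φ)
    (hadd : ∀ z s t, Φ (Φ (z, s), t) = Φ (z, s + t))
    (hrec : ∃ t : ℕ → ℝ≥0, Tendsto t atTop atTop ∧ Tendsto (fun n ↦ Φ (z, t n)) atTop (𝓝 z))
    (hper : ∀ p, 0 < p → Φ (z, p) ≠ z) : Function.Injective fun t ↦ Φ (z, t) := by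
  have key : ∀ s p : ℝ≥0, 0 < p → Φ (z, s + p) ≠ Φ (z, s) := by
    intro s p hp heq
    have hshift : ∀ s', s ≤ s' → Φ (z, s' + p) = Φ (z, s') := by
      intro s' hs'
      obtain ⟨c, rfl⟩ := exists_add_of_le hs'
      rw [add_right_comm, ← hadd, heq, hadd]
    have hmul : ∀ (n : ℕ) s', s ≤ s' → Φ (z, s' + n * p) = Φ (z, s') := by
      intro n
      induction n with
      | zero => intro s' _; simp
      | succ n ih =>
        intro s' hs'
        rw [Nat.cast_succ, add_mul, one_mul, ← add_assoc, hshift _ (hs'.trans le_self_add),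
          ih s' hs']
    have hK : IsClosed ((fun t ↦ Φ (z, t)) '' Icc s (s + p)) :=
      (isCompact_Icc.image (by fun_prop)).isClosed
    have hmem : ∀ t, s ≤ t → Φ (z, t) ∈ (fun t ↦ Φ (z, t)) '' Icc s (s + p) := by
      intro t ht
      obtain ⟨m, h1, h2⟩ : ∃ m : ℕ, (m : ℝ≥0) * p ≤ t - s ∧ t - s < (m + 1) * p :=
        ⟨⌊(t - s) / p⌋₊, (le_div_iff₀ hp).1 (Nat.floor_le zero_le),
          (div_lt_iff₀ hp).1 (Nat.lt_floor_add_one _)⟩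
      obtain ⟨c, hc⟩ := exists_add_of_le h1
      have hts : t = s + c + m * p := by
        rw [add_assoc, add_comm c, ← hc, add_tsub_cancel_of_le ht]
      refine ⟨s + c, ⟨le_self_add, ?_⟩, ?_⟩
      · rw [add_mul, one_mul, hc] at h2
        exact add_le_add_right (lt_of_add_lt_add_left h2).le s
      · conv_rhs => rw [hts]
        exact (hmul _ _ le_self_add).symm
    obtain ⟨t, ht, htz⟩ := hrec
    obtain ⟨s', hs', hz⟩ := hK.mem_of_tendsto htz
      ((ht.eventually_ge_atTop s).mono fun n hn ↦ hmem _ hn)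
    have hz' : Φ (z, s') = z := hz
    apply hper p hp
    calc Φ (z, p) = Φ (Φ (z, s'), p) := by rw [hz']
      _ = z := by rw [hadd, hshift s' hs'.1, hz']
  intro a b hab
  by_contra hne
  rcases lt_or_gt_of_ne hne with h | h
  · obtain ⟨p, hp, rfl⟩ := exists_pos_add_of_lt' h
    exact key a p hp hab.symm
  · obtain ⟨p, hp, rfl⟩ := exists_pos_add_of_lt' h
    exact key b p hp hab

/-- If the complement of `z` embeds in the plane, then the semiorbit of a recurrent nonperiodic
point `z`, started at time one, gives a recurrent planar curve. -/
theorem recurrentCurve_of_recurrent [T2Space X] (hΦ : Continuous Φ)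
    (hadd : ∀ z s t, Φ (Φ (z, s), t) = Φ (z, s + t))
    (hrec : ∃ t : ℕ → ℝ≥0, Tendsto t atTop atTop ∧ Tendsto (fun n ↦ Φ (z, t n)) atTop (𝓝 z))
    (hper : ∀ p, 0 < p → Φ (z, p) ≠ z) {f : X → ℂ} (hf : ContinuousOn f {z}ᶜ)
    (hinj : InjOn f {z}ᶜ)
    (hopen : ∀ x ≠ z, ∀ U ∈ 𝓝 x, ∃ δ > 0, ∀ y ≠ z, ‖f y - f x‖ < δ → y ∈ U) :
    RecurrentCurve fun t : ℝ ↦ f (Φ (z, t.toNNReal + 1)) := by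
  have hpos : ∀ s : ℝ≥0, Φ (z, s + 1) ≠ z := fun s ↦ hper _ (by positivity)
  have hfc : ∀ x ≠ z, ContinuousAt f x := fun x hx ↦
    hf.continuousAt (isOpen_compl_singleton.mem_nhds hx)
  refine ⟨?_, ?_, ?_, ?_⟩
  · refine continuous_iff_continuousAt.2 fun t ↦ ContinuousAt.comp (g := f) (hfc _ (hpos _)) ?_
    have : Continuous fun t : ℝ ↦ Φ (z, t.toNNReal + 1) := by
      have := continuous_real_toNNReal
      fun_prop
    exact this.continuousAt
  · intro a ha b hb hab
    have h1 := injective_orbit_of_recurrent hΦ hadd hrec hper (hinj (hpos _) (hpos _) hab)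
    exact (Real.toNNReal_eq_toNNReal_iff ha hb).1 (add_right_cancel h1)
  · intro s hs R ε hε
    have hsum : ∀ t r : ℝ, 0 ≤ t → 0 ≤ r →
        Φ (Φ (z, t.toNNReal + 1), r.toNNReal) = Φ (z, (t + r).toNNReal + 1) := by
      intro t r ht hr
      rw [hadd, Real.toNNReal_add ht hr, add_right_comm]
    have hev : ∀ᶠ x in 𝓝 (Φ (z, s.toNNReal + 1)), ∀ r ∈ Icc 0 R,
        ‖f (Φ (x, r.toNNReal)) - f (Φ (z, (s + r).toNNReal + 1))‖ < ε := by
      refine isCompact_Icc.eventually_forall_of_forall_eventually fun r hr ↦ ?_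
      have hc1 : ContinuousAt (fun q : X × ℝ ↦ f (Φ (q.1, q.2.toNNReal)))
          (Φ (z, s.toNNReal + 1), r) := by
        refine ContinuousAt.comp (g := f) (hfc _ ?_) ?_
        · simp only [hsum s r hs hr.1]
          exact hpos _
        · have : Continuous fun q : X × ℝ ↦ Φ (q.1, q.2.toNNReal) := by
            have := continuous_real_toNNReal
            fun_prop
          exact this.continuousAt
      have hc2 : ContinuousAt (fun q : X × ℝ ↦ f (Φ (z, (s + q.2).toNNReal + 1)))
          (Φ (z, s.toNNReal + 1), r) := by
        refine ContinuousAt.comp (g := f) (hfc _ (hpos _)) ?_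
        have : Continuous fun q : X × ℝ ↦ Φ (z, (s + q.2).toNNReal + 1) := by
          have := continuous_real_toNNReal
          fun_prop
        exact this.continuousAt
      refine (hc1.sub hc2).norm.eventually_lt_const ?_
      simpa [hsum s r hs hr.1] using hε
    obtain ⟨δ, hδ, H⟩ := hopen _ (hpos _) _ hev
    refine ⟨δ, hδ, fun t ht htδ r hr ↦ ?_⟩
    have := H _ (hpos _) htδ r hr
    rwa [hsum t r ht hr.1] at this
  · obtain ⟨t, ht, htz⟩ := hrec
    refine ⟨fun n ↦ t n, NNReal.tendsto_coe_atTop.2 ht, ?_⟩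
    refine (hfc _ (hpos _)).tendsto.comp ?_
    have : Tendsto (fun n ↦ Φ (Φ (z, t n), 1)) atTop (𝓝 (Φ (z, 1))) :=
      (hΦ.tendsto (z, 1)).comp (htz.prodMk_nhds tendsto_const_nhds)
    simpa [hadd] using this

end Semiflow

/-- Stereographic projection: the complement of a point of the sphere embeds in the plane. -/
theorem exists_planar_embedding {Z : Set (EuclideanSpace ℝ (Fin 3))}
    (hZ : Z ⊆ Metric.sphere 0 1) (z : Z) :
    ∃ f : Z → ℂ, ContinuousOn f {z}ᶜ ∧ InjOn f {z}ᶜ ∧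
      ∀ x ≠ z, ∀ U ∈ 𝓝 x, ∃ δ > 0, ∀ y ≠ z, ‖f y - f x‖ < δ → y ∈ U := by
  have : Fact (Module.finrank ℝ (EuclideanSpace ℝ (Fin 3)) = 2 + 1) := ⟨by simp⟩
  set ι : Z → Metric.sphere (0 : EuclideanSpace ℝ (Fin 3)) 1 := inclusion hZ with hι
  have hemb : IsEmbedding ι := .inclusion hZ
  set e := stereographic' 2 (ι z) with he
  set g := Complex.orthonormalBasisOneI.repr.symm with hg
  have hsrc : ∀ x ≠ z, ι x ∈ e.source := by
    intro x hx
    rw [he, stereographic'_source]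
    exact fun h ↦ hx (hemb.injective h)
  refine ⟨fun x ↦ g (e (ι x)), ?_, ?_, ?_⟩
  · exact g.continuous.comp_continuousOn
      (e.continuousOn.comp hemb.continuous.continuousOn fun x hx ↦ hsrc x hx)
  · intro x hx y hy hxy
    exact hemb.injective (e.injOn (hsrc x hx) (hsrc y hy) (g.injective hxy))
  · intro x hx U hU
    obtain ⟨V, hV, hVU⟩ := (hemb.isInducing.nhds_eq_comap x ▸ hU : U ∈ comap ι (𝓝 (ι x)))
    have hxs := hsrc x hx
    have hc := e.continuousAt_symm (e.map_source hxs)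
    have hmem : e.symm ⁻¹' V ∈ 𝓝 (e (ι x)) := hc (by rwa [e.left_inv hxs])
    obtain ⟨δ, hδ, H⟩ := Metric.mem_nhds_iff.1 hmem
    refine ⟨δ, hδ, fun y hy hyx ↦ hVU ?_⟩
    have hy' : e (ι y) ∈ Metric.ball (e (ι x)) δ := by
      rwa [Metric.mem_ball, ← g.dist_map, dist_eq_norm]
    have := H hy'
    rwa [mem_preimage, e.left_inv (hsrc y hy)] at this

end PlanarRecurrence

/-- Poincaré–Bendixson theorem for continuous semiflows on compact subsets of the
unit sphere `S²` of `ℝ³`: every recurrent point is a fixed point or a periodic point. -/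
theorem semiflow_sphere_recurrent_fixed_or_periodic
    (Z : Set (EuclideanSpace ℝ (Fin 3))) (hZc : IsCompact Z)
    (hZs : Z ⊆ Metric.sphere (0 : EuclideanSpace ℝ (Fin 3)) 1)
    (Φ : Z × ℝ≥0 → Z) (hΦ : Continuous Φ)
    (h0 : ∀ z : Z, Φ (z, 0) = z)
    (hadd : ∀ (z : Z) (s t : ℝ≥0), Φ (Φ (z, s), t) = Φ (z, s + t))
    (z : Z)
    (hrec : ∃ t : ℕ → ℝ≥0, Tendsto t atTop atTop ∧
      Tendsto (fun n => Φ (z, t n)) atTop (𝓝 z)) :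
    (∀ t : ℝ≥0, Φ (z, t) = z) ∨ (∃ p : ℝ≥0, 0 < p ∧ Φ (z, p) = z) := by
  refine Or.inr (by_contra fun hper ↦ ?_)
  obtain ⟨f, hf, hinj, hopen⟩ := PlanarRecurrence.exists_planar_embedding hZs z
  exact (PlanarRecurrence.recurrentCurve_of_recurrent hΦ hadd hrec
    (fun p hp h ↦ hper ⟨p, hp, h⟩) hf hinj hopen).false
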